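/- Let 1 < p ≤ q < ∞ and let ω, ν ∈ D be radial weights with ω̂, ν̂ > 0 on [0,1). Then there exists r_0 = r_0(ν) > 0, with ν(Δ(z,r)) > 0 for all z ∈ 𝔻 and all r ≥ r_0, such that for every r ≥ r_0 and every analytic function f on 𝔻: ∥f∥_{BMO(Δ)_{ω,ν,p,q,r}} < ∞ if and only if sup_{z∈𝔻} |f'(z)|(1−|z|)γ(z) < ∞. -/

import Mathlib

open MeasureTheory Set
open scoped ENNReal ComplexConjugate

noncomputable section

/-- The open unit disc in `ℂ`. -/
def UD : Set ℂ := Metric.ball (0 : ℂ) 1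

/-- Normalized area measure `dA = dx dy / π` on `ℂ`. -/
def dA : Measure ℂ := (ENNReal.ofReal Real.pi)⁻¹ • (MeasureTheory.volume : Measure ℂ)

/-- `ω̂(r) = ∫_r^1 ω(s) ds` for a (radial) weight `ω : ℂ → ℝ`. -/
def what (ω : ℂ → ℝ) (r : ℝ) : ℝ := ∫ s in r..(1 : ℝ), ω (s : ℂ)

/-- A radial weight: nonnegative, radial, integrable over the unit disc. -/
def RadialWeight (ω : ℂ → ℝ) : Prop :=
  (∀ z, 0 ≤ ω z) ∧ (∀ z : ℂ, ω z = ω ((‖z‖ : ℝ) : ℂ)) ∧ IntegrableOn ω UD dA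

/-- `ω̂ > 0` on `[0,1)`. -/
def WhatPos (ω : ℂ → ℝ) : Prop := ∀ r : ℝ, 0 ≤ r → r < 1 → 0 < what ω r

/-- The class `D̂`. -/
def Dhat (ω : ℂ → ℝ) : Prop :=
  ∃ C > (1 : ℝ), ∀ r : ℝ, 0 ≤ r → r < 1 → what ω r ≤ C * what ω ((1 + r) / 2)

/-- The class `Ď`. -/
def Dcheck (ω : ℂ → ℝ) : Prop :=
  ∃ K > (1 : ℝ), ∃ C > (1 : ℝ), ∀ r : ℝ, 0 ≤ r → r < 1 →
    C * what ω (1 - (1 - r) / K) ≤ what ω r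

/-- The class `D = D̂ ∩ Ď`. -/
def Dclass (ω : ℂ → ℝ) : Prop := Dhat ω ∧ Dcheck ω

/-- A `Ď`-exponent `α > 0` for `ω`: `ω̂(t) ≤ C ((1-t)/(1-r))^α ω̂(r)` for `0 ≤ r ≤ t < 1`. -/
def DcheckExp (ω : ℂ → ℝ) (α : ℝ) : Prop :=
  ∃ C > (0 : ℝ), ∀ r t : ℝ, 0 ≤ r → r ≤ t → t < 1 →
    what ω t ≤ C * ((1 - t) / (1 - r)) ^ α * what ω r

/-- A `D̂`-exponent `β > 0` for `ω`: `ω̂(r) ≤ C ((1-r)/(1-t))^β ω̂(t)` for `0 ≤ r ≤ t < 1`. -/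
def DhatExp (ω : ℂ → ℝ) (β : ℝ) : Prop :=
  ∃ C > (0 : ℝ), ∀ r t : ℝ, 0 ≤ r → r ≤ t → t < 1 →
    what ω r ≤ C * ((1 - r) / (1 - t)) ^ β * what ω t

/-- Weighted `L^p` "norm" over the unit disc. -/
def wnorm (p : ℝ) (ω : ℂ → ℝ) (f : ℂ → ℂ) : ℝ :=
  (∫ z in UD, ‖f z‖ ^ p * ω z ∂dA) ^ (1 / p)

/-- Membership in the weighted Lebesgue space `L^p_ω`. -/
def MemLw (p : ℝ) (ω : ℂ → ℝ) (f : ℂ → ℂ) : Prop :=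
  AEStronglyMeasurable f (dA.restrict UD) ∧
  IntegrableOn (fun z => ‖f z‖ ^ p * ω z) UD dA

/-- Membership in the weighted Bergman space `A^p_ω`. -/
def MemAp (p : ℝ) (ω : ℂ → ℝ) (f : ℂ → ℂ) : Prop :=
  DifferentiableOn ℂ f UD ∧ IntegrableOn (fun z => ‖f z‖ ^ p * ω z) UD dA

/-- `H^∞`: bounded analytic functions on the unit disc. -/
def Hinfty (f : ℂ → ℂ) : Prop :=
  DifferentiableOn ℂ f UD ∧ ∃ M : ℝ, ∀ z ∈ UD, ‖f z‖ ≤ M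

/-- Moments `ν_x = ∫_0^1 t^x ν(t) dt`. -/
def mom (ν : ℂ → ℝ) (x : ℝ) : ℝ := ∫ t in (0 : ℝ)..1, t ^ x * ν (t : ℂ)

/-- The Bergman reproducing kernel of `A²_ν`. -/
def Bker (ν : ℂ → ℝ) (z ζ : ℂ) : ℂ :=
  ∑' n : ℕ, (ζ * conj z) ^ n / (((2 * mom ν (2 * (n : ℝ) + 1) : ℝ)) : ℂ)

/-- The Bergman projection `P_ν`. -/
def Pw (ν : ℂ → ℝ) (f : ℂ → ℂ) (z : ℂ) : ℂ :=
  ∫ ζ in UD, f ζ * conj (Bker ν z ζ) * ((ν ζ : ℝ) : ℂ) ∂dA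

/-- The Hankel operator `H_f^ν(g) = f g − P_ν(f g)`. -/
def Hankel (ν : ℂ → ℝ) (f g : ℂ → ℂ) (z : ℂ) : ℂ :=
  f z * g z - Pw ν (fun ζ => f ζ * g ζ) z

/-- The standard weighted Bergman projection `P_η`. -/
def Pstd (η : ℝ) (f : ℂ → ℂ) (z : ℂ) : ℂ :=
  (((η + 1 : ℝ)) : ℂ) *
    ∫ ζ in UD, f ζ * (((1 - ‖ζ‖ ^ 2) ^ η : ℝ) : ℂ) *
      (1 - z * conj ζ) ^ (((-(2 + η) : ℝ)) : ℂ) ∂dA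

/-- The Bekollé–Bonami class `B_q` (for radial weights). -/
def Bq (q : ℝ) (ν : ℂ → ℝ) : Prop :=
  ∃ η > (-1 : ℝ), ∃ C > (0 : ℝ), ∀ f : ℂ → ℂ, MemLw q ν f →
    wnorm q ν (Pstd η f) ≤ C * wnorm q ν f

/-- Pseudo-hyperbolic distance. -/
def pd (z ζ : ℂ) : ℝ := ‖(z - ζ) / (1 - conj z * ζ)‖

/-- Hyperbolic distance `β(z,ζ)`. -/
def hyp (z ζ : ℂ) : ℝ := (1 / 2) * Real.log ((1 + pd z ζ) / (1 - pd z ζ))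

/-- The hyperbolic disc `Δ(z,r)`. -/
def hDisc (z : ℂ) (r : ℝ) : Set ℂ := {ζ ∈ UD | hyp z ζ < r}

/-- `ν(Δ(z,r))`. -/
def nuD (ν : ℂ → ℝ) (z : ℂ) (r : ℝ) : ℝ := ∫ ζ in hDisc z r, ν ζ ∂dA

/-- The function `γ(z)`. -/
def gam (ω ν : ℂ → ℝ) (p q : ℝ) (z : ℂ) : ℝ :=
  (what ν ‖z‖) ^ (1 / q) * (1 - ‖z‖) ^ (1 / q) /
    ((what ω ‖z‖) ^ (1 / p) * (1 - ‖z‖) ^ (1 / p))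

/-- The average `f̂_{r,ν}(z)`. -/
def havg (ν : ℂ → ℝ) (r : ℝ) (f : ℂ → ℂ) (z : ℂ) : ℂ :=
  (∫ ζ in hDisc z r, ν ζ • f ζ ∂dA) / ((nuD ν z r : ℝ) : ℂ)

/-- The mean oscillation `MO_{ν,q,r}(f)(z)`. -/
def MO (ν : ℂ → ℝ) (q r : ℝ) (f : ℂ → ℂ) (z : ℂ) : ℝ :=
  ((∫ ζ in hDisc z r, ‖f ζ - havg ν r f z‖ ^ q * ν ζ ∂dA) / nuD ν z r) ^ (1 / q)

/-- Finiteness of the `BMO(Δ)_{ω,ν,p,q,r}` norm. -/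
def BMOfin (ω ν : ℂ → ℝ) (p q r : ℝ) (f : ℂ → ℂ) : Prop :=
  ∃ M : ℝ, ∀ z ∈ UD, MO ν q r f z * gam ω ν p q z ≤ M

/-- Boundedness of the Hankel operator `H_f^ν : A^p_ω → L^q_ν` tested on `H^∞`. -/
def HankelBdd (p q : ℝ) (ω ν : ℂ → ℝ) (f : ℂ → ℂ) : Prop :=
  ∃ C > (0 : ℝ), ∀ g : ℂ → ℂ, Hinfty g → wnorm q ν (Hankel ν f g) ≤ C * wnorm p ω g

/-- `ω̂` extended by the convention `ω̂(t) = ω̂(0)` for `t < 0`. -/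
def whatE (ω : ℂ → ℝ) (t : ℝ) : ℝ := what ω (max t 0)

/-- The function `Γ_τ(z,ζ)`. -/
def Gam (ω ν : ℂ → ℝ) (p q τ : ℝ) (z ζ : ℂ) : ℝ :=
  ((‖1 - conj z * ζ‖ ^ 2 / max (1 - ‖z‖ ^ 2) (1 - ‖ζ‖ ^ 2)) ^ (1 / p - (τ + 1) / q) *
      whatE ω (1 - 2 * ‖1 - conj z * ζ‖ ^ 2 / max (1 - ‖z‖ ^ 2) (1 - ‖ζ‖ ^ 2)) ^ (1 / p)) /
    (min (what ν ‖z‖ / (1 - ‖z‖) ^ τ) (what ν ‖ζ‖ / (1 - ‖ζ‖) ^ τ)) ^ (1 / q)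

/-- The generalized Berezin transform `B_{ν,c,σ}(φ)(z)` of a real-valued `φ`. -/
def Ber (ν : ℂ → ℝ) (c σ : ℝ) (φ : ℂ → ℝ) (z : ℂ) : ℝ :=
  (1 - ‖z‖ ^ 2) ^ (c + 1) / what ν ‖z‖ *
    ∫ ζ in UD, φ ζ * (1 - ‖ζ‖ ^ 2) ^ σ * ‖1 - z * conj ζ‖ ^ (-(2 + c + σ)) * ν ζ ∂dA

/-- The operator `T_{b,c}`. -/
def Tbc (b c : ℝ) (f : ℂ → ℂ) (z : ℂ) : ℂ :=
  ∫ ζ in UD, f ζ * (((1 - ‖ζ‖ ^ 2) ^ b : ℝ) : ℂ) * (1 - z * conj ζ) ^ (((-c : ℝ)) : ℂ) ∂dA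

/-- The operator `S_{b,c}`. -/
def Sbc (b c : ℝ) (f : ℂ → ℂ) (z : ℂ) : ℂ :=
  ∫ ζ in UD, f ζ * ((((1 - ‖ζ‖ ^ 2) ^ b * ‖1 - z * conj ζ‖ ^ (-c)) : ℝ) : ℂ) ∂dA

/-- The standard kernel `B^η_z(ζ) = (1 − conj(z) ζ)^{−(2+η)}`. -/
def Bstd (η : ℝ) (z ζ : ℂ) : ℂ := (1 - conj z * ζ) ^ (((-(2 + η) : ℝ)) : ℂ)

/-- The normalized kernel `b^η_{z,ω}`. -/
def bnrm (p : ℝ) (ω : ℂ → ℝ) (η : ℝ) (z ζ : ℂ) : ℂ :=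
  Bstd η z ζ / ((wnorm p ω (Bstd η z) : ℝ) : ℂ)

/-- The function `g^η_{z,ω} = P_ν(conj(f) b^η_{z,ω}) / b^η_{z,ω}`. -/
def gfn (ν : ℂ → ℝ) (p : ℝ) (ω : ℂ → ℝ) (η : ℝ) (f : ℂ → ℂ) (z ζ : ℂ) : ℂ :=
  Pw ν (fun u => conj (f u) * bnrm p ω η z u) ζ / bnrm p ω η z ζ

end

lemma mem_UD {z : ℂ} : z ∈ UD ↔ ‖z‖ < 1 := by simp [UD]

lemma isOpen_UD : IsOpen UD := Metric.isOpen_ball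

lemma one_sub_norm_le_norm_one_sub {z ζ : ℂ} (hz : z ∈ UD) :
    1 - ‖ζ‖ ≤ ‖1 - conj z * ζ‖ := by
  rw [mem_UD] at hz
  have h1 : ‖(1 : ℂ)‖ - ‖conj z * ζ‖ ≤ ‖1 - conj z * ζ‖ := norm_sub_norm_le _ _
  rw [norm_mul, RCLike.norm_conj, norm_one] at h1
  nlinarith [norm_nonneg ζ, norm_nonneg z]

lemma norm_one_sub_conj_mul_comm (z ζ : ℂ) : ‖1 - conj z * ζ‖ = ‖1 - conj ζ * z‖ := by
  rw [← RCLike.norm_conj]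
  congr 1
  simp [mul_comm]

lemma norm_one_sub_conj_mul_sq (z ζ : ℂ) :
    ‖1 - conj z * ζ‖ ^ 2 - ‖z - ζ‖ ^ 2 = (1 - ‖z‖ ^ 2) * (1 - ‖ζ‖ ^ 2) := by
  simp only [Complex.sq_norm, Complex.normSq_apply]
  simp
  ring

lemma norm_one_sub_conj_mul_pos {z ζ : ℂ} (hz : z ∈ UD) (hζ : ζ ∈ UD) :
    0 < ‖1 - conj z * ζ‖ := by
  have := one_sub_norm_le_norm_one_sub (ζ := ζ) hz
  rw [mem_UD] at hζ
  linarith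

lemma one_sub_sq_norm_pos {z : ℂ} (hz : z ∈ UD) : 0 < 1 - ‖z‖ ^ 2 := by
  rw [mem_UD] at hz
  nlinarith [norm_nonneg z]

lemma norm_sub_lt_norm_one_sub {z ζ : ℂ} (hz : z ∈ UD) (hζ : ζ ∈ UD) :
    ‖z - ζ‖ < ‖1 - conj z * ζ‖ := by
  have h := norm_one_sub_conj_mul_sq z ζ
  have h2 := mul_pos (one_sub_sq_norm_pos hz) (one_sub_sq_norm_pos hζ)
  exact lt_of_pow_lt_pow_left₀ 2 (norm_nonneg _) (by linarith)

lemma one_sub_pd_sq {z ζ : ℂ} (hz : z ∈ UD) (hζ : ζ ∈ UD) :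
    (1 - pd z ζ ^ 2) * ‖1 - conj z * ζ‖ ^ 2 = (1 - ‖z‖ ^ 2) * (1 - ‖ζ‖ ^ 2) := by
  have h := norm_one_sub_conj_mul_sq z ζ
  have := norm_one_sub_conj_mul_pos hz hζ
  rw [← h, pd, norm_div, div_pow, sub_mul, one_mul, div_mul_cancel₀ _ (by positivity)]

lemma pd_nonneg (z ζ : ℂ) : 0 ≤ pd z ζ := norm_nonneg _

lemma pd_lt_one {z ζ : ℂ} (hz : z ∈ UD) (hζ : ζ ∈ UD) : pd z ζ < 1 := by
  rw [pd, norm_div, div_lt_one (norm_one_sub_conj_mul_pos hz hζ)]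
  exact norm_sub_lt_norm_one_sub hz hζ

lemma hyp_lt_iff {z ζ : ℂ} (hz : z ∈ UD) (hζ : ζ ∈ UD) (r : ℝ) :
    hyp z ζ < r ↔ 1 + pd z ζ < Real.exp (2 * r) * (1 - pd z ζ) := by
  have h1 := pd_lt_one hz hζ
  have h0 := pd_nonneg z ζ
  rw [hyp, ← div_lt_iff₀ (by linarith), ← Real.log_lt_iff_lt_exp (div_pos (by linarith) (by linarith))]
  constructor <;> intro h <;> linarith

lemma norm_one_sub_le_of_mem_hDisc {z ζ : ℂ} {r : ℝ} (hz : z ∈ UD) (h : ζ ∈ hDisc z r) :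
    ‖1 - conj z * ζ‖ ≤ 4 * Real.exp (2 * r) * (1 - ‖z‖) ∧
      ‖1 - conj z * ζ‖ ≤ 4 * Real.exp (2 * r) * (1 - ‖ζ‖) := by
  obtain ⟨hζ, h⟩ := h
  rw [hyp_lt_iff hz hζ] at h
  have h1 := pd_lt_one hz hζ
  have h0 := pd_nonneg z ζ
  have hE := Real.exp_pos (2 * r)
  have e := one_sub_pd_sq hz hζ
  have hp := norm_one_sub_conj_mul_pos hz hζ
  have hA := one_sub_norm_le_norm_one_sub (ζ := ζ) hz
  have hB := one_sub_norm_le_norm_one_sub (ζ := z) hζ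
  rw [norm_one_sub_conj_mul_comm] at hB
  rw [mem_UD] at hz hζ
  set L := ‖1 - conj z * ζ‖
  have h2 : 1 ≤ Real.exp (2 * r) * (1 - pd z ζ ^ 2) := by nlinarith
  have h3 : L ^ 2 ≤ Real.exp (2 * r) * ((1 - ‖z‖ ^ 2) * (1 - ‖ζ‖ ^ 2)) := by
    rw [← e]; nlinarith [sq_nonneg L]
  have hz0 := norm_nonneg z
  have hζ0 := norm_nonneg ζ
  have h4 : (1 - ‖z‖ ^ 2) * (1 - ‖ζ‖ ^ 2) ≤ 4 * ((1 - ‖z‖) * (1 - ‖ζ‖)) := by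
    have : (1 - ‖z‖ ^ 2) * (1 - ‖ζ‖ ^ 2) =
      ((1 + ‖z‖) * (1 + ‖ζ‖)) * ((1 - ‖z‖) * (1 - ‖ζ‖)) := by ring
    rw [this]
    apply mul_le_mul_of_nonneg_right _ (mul_nonneg (by linarith) (by linarith))
    nlinarith
  have h5 : L ^ 2 ≤ Real.exp (2 * r) * (4 * ((1 - ‖z‖) * (1 - ‖ζ‖))) :=
    h3.trans (mul_le_mul_of_nonneg_left h4 hE.le)
  constructor
  · have : L * L ≤ (4 * Real.exp (2 * r) * (1 - ‖z‖)) * L := by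
      have := mul_le_mul_of_nonneg_left hA
        (by have : 0 ≤ 1 - ‖z‖ := by linarith
            positivity : 0 ≤ 4 * Real.exp (2 * r) * (1 - ‖z‖))
      nlinarith
    exact le_of_mul_le_mul_right this hp
  · have : L * L ≤ (4 * Real.exp (2 * r) * (1 - ‖ζ‖)) * L := by
      have := mul_le_mul_of_nonneg_left hB
        (by have : 0 ≤ 1 - ‖ζ‖ := by linarith
            positivity : 0 ≤ 4 * Real.exp (2 * r) * (1 - ‖ζ‖))
      nlinarith
    exact le_of_mul_le_mul_right this hp

lemma mem_hDisc_of_norm_one_sub_le {z ζ : ℂ} {r b : ℝ} (hz : z ∈ UD) (hζ : ζ ∈ UD) (hb : 0 < b)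
    (hbr : 4 < b * Real.exp (2 * r))
    (h : b * ‖1 - conj z * ζ‖ ^ 2 ≤ (1 - ‖z‖ ^ 2) * (1 - ‖ζ‖ ^ 2)) : ζ ∈ hDisc z r := by
  refine ⟨hζ, ?_⟩
  rw [hyp_lt_iff hz hζ]
  have h1 := pd_lt_one hz hζ
  have h0 := pd_nonneg z ζ
  have hp := norm_one_sub_conj_mul_pos hz hζ
  rw [← one_sub_pd_sq hz hζ] at h
  have h2 : b ≤ 1 - pd z ζ ^ 2 := le_of_mul_le_mul_right h (by positivity)
  have hE := Real.exp_pos (2 * r)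
  have h3 : 4 < Real.exp (2 * r) * (1 - pd z ζ ^ 2) := by nlinarith
  have h4 : (1 + pd z ζ) * (1 + pd z ζ) < Real.exp (2 * r) * (1 - pd z ζ) * (1 + pd z ζ) := by
    nlinarith
  exact lt_of_mul_lt_mul_right h4 (by linarith)

lemma measurableSet_hDisc (z : ℂ) (r : ℝ) : MeasurableSet (hDisc z r) := by
  have h : Measurable (hyp z) := by
    unfold hyp pd
    fun_prop
  exact isOpen_UD.measurableSet.inter (measurableSet_lt h measurable_const)

lemma hDisc_subset_UD (z : ℂ) (r : ℝ) : hDisc z r ⊆ UD := fun _ h => h.1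

lemma abs_le_norm_one_sub_exp {x θ : ℝ} (hx0 : 0 ≤ x) (hx1 : x ≤ 1) (hθ : |θ| ≤ Real.pi) :
    |θ| ≤ Real.pi * ‖1 - (x : ℂ) * Complex.exp (θ * Complex.I)‖ := by
  have h1 : ‖Complex.exp (Complex.I * θ) - 1‖ = ‖2 * Real.sin (θ / 2)‖ :=
    Complex.norm_exp_I_mul_ofReal_sub_one θ
  have h2 : 2 / Real.pi * |θ / 2| ≤ |Real.sin (θ / 2)| :=
    Real.mul_abs_le_abs_sin (by rw [abs_div, abs_two]; linarith)
  have h3 : ‖Complex.exp (Complex.I * θ) - 1‖ ≤ 2 * ‖1 - (x : ℂ) * Complex.exp (θ * Complex.I)‖ := by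
    rw [mul_comm Complex.I]
    set e := Complex.exp (θ * Complex.I)
    have he : ‖e‖ = 1 := Complex.norm_exp_ofReal_mul_I θ
    have h4 : ‖e - 1‖ ≤ ‖1 - x * e‖ + (1 - x) := by
      have : e - 1 = -(1 - x * e) + ((1 - x : ℝ) : ℂ) * e := by push_cast; ring
      rw [this]
      refine (norm_add_le _ _).trans ?_
      rw [norm_neg, norm_mul, he, Complex.norm_real, Real.norm_of_nonneg (by linarith), mul_one]
    have h5 : 1 - x ≤ ‖1 - x * e‖ := by
      have := norm_sub_norm_le (1 : ℂ) (x * e)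
      rwa [norm_mul, he, Complex.norm_real, Real.norm_of_nonneg hx0, mul_one, norm_one] at this
    linarith
  rw [h1, norm_mul, Real.norm_eq_abs, Real.norm_eq_abs, abs_two] at h3
  rw [abs_div, abs_two] at h2
  have hpi := Real.pi_pos
  have h6 : 2 / Real.pi * (|θ| / 2) = |θ| / Real.pi := by field_simp
  rw [h6, div_le_iff₀ hpi] at h2
  nlinarith

lemma WhatPos.intervalIntegrable {ω : ℂ → ℝ} (h : WhatPos ω) :
    IntervalIntegrable (fun s : ℝ => ω s) volume 0 1 := by
  by_contra hn
  have := h 0 le_rfl one_pos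
  rw [what, intervalIntegral.integral_undef hn] at this
  exact lt_irrefl _ this

lemma WhatPos.intervalIntegrable_of_mem {ω : ℂ → ℝ} (h : WhatPos ω) {a b : ℝ}
    (ha : a ∈ Icc (0 : ℝ) 1) (hb : b ∈ Icc (0 : ℝ) 1) :
    IntervalIntegrable (fun s : ℝ => ω s) volume a b :=
  h.intervalIntegrable.mono_set (by
    rw [uIcc_of_le (zero_le_one' ℝ)]
    exact uIcc_subset_Icc ha hb)

lemma what_sub_what {ω : ℂ → ℝ} (h : WhatPos ω) {s t : ℝ} (hs : 0 ≤ s) (hst : s ≤ t)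
    (ht : t ≤ 1) : what ω s - what ω t = ∫ x in s..t, ω (x : ℂ) := by
  have h1 := h.intervalIntegrable_of_mem (a := s) (b := t) ⟨hs, hst.trans ht⟩ ⟨hs.trans hst, ht⟩
  have h2 := h.intervalIntegrable_of_mem (a := t) (b := 1) ⟨hs.trans hst, ht⟩ ⟨zero_le_one, le_rfl⟩
  rw [what, what, ← intervalIntegral.integral_add_adjacent_intervals h1 h2]
  ring

lemma what_anti {ω : ℂ → ℝ} (h0 : ∀ z, 0 ≤ ω z) (h : WhatPos ω) {s t : ℝ} (hs : 0 ≤ s)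
    (hst : s ≤ t) (ht : t ≤ 1) : what ω t ≤ what ω s := by
  have := what_sub_what h hs hst ht
  have h2 : 0 ≤ ∫ x in s..t, ω (x : ℂ) :=
    intervalIntegral.integral_nonneg hst fun _ _ => h0 _
  linarith

/-- Iterated doubling for weights in `D̂`. -/
lemma Dhat.what_le_pow_mul {ω : ℂ → ℝ} (h0 : ∀ z, 0 ≤ ω z) (h : WhatPos ω) {C : ℝ} (hC : 1 < C)
    (hD : ∀ r : ℝ, 0 ≤ r → r < 1 → what ω r ≤ C * what ω ((1 + r) / 2)) (k : ℕ) :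
    ∀ s t : ℝ, 0 ≤ s → s < 1 → 0 ≤ t → t < 1 → 1 - s ≤ 2 ^ k * (1 - t) →
      what ω s ≤ C ^ k * what ω t := by
  induction k with
  | zero =>
    intro s t hs _ ht ht1 hst
    simpa using what_anti h0 h ht (by linarith) (by linarith)
  | succ k ih =>
    intro s t hs hs1 ht ht1 hst
    rw [pow_succ] at hst
    have := ih ((1 + s) / 2) t (by linarith) (by linarith) ht ht1 (by linarith)
    calc what ω s ≤ C * what ω ((1 + s) / 2) := hD s hs hs1
      _ ≤ C * (C ^ k * what ω t) := by gcongr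
      _ = _ := by ring

lemma Dhat.exists_what_le_mul {ω : ℂ → ℝ} (h0 : ∀ z, 0 ≤ ω z) (h : WhatPos ω) (hD : Dhat ω)
    (L : ℝ) : ∃ C > 0, ∀ s t : ℝ, 0 ≤ s → s < 1 → 0 ≤ t → t < 1 → 1 - s ≤ L * (1 - t) →
      what ω s ≤ C * what ω t := by
  obtain ⟨C, hC, hD⟩ := hD
  obtain ⟨k, hk⟩ := pow_unbounded_of_one_lt L (one_lt_two : (1 : ℝ) < 2)
  refine ⟨C ^ k, by positivity, fun s t hs hs1 ht ht1 hst => ?_⟩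
  exact Dhat.what_le_pow_mul h0 h hC hD k s t hs hs1 ht ht1
    (hst.trans (mul_le_mul_of_nonneg_right hk.le (by linarith)))

/-- The radial part `ρ ν(ρ) dρ` on `(0, 1)` of the measure `ν dA`. -/
noncomputable def radMeas (ν : ℂ → ℝ) : Measure ℝ :=
  (volume.restrict (Ioo 0 1)).withDensity fun ρ => ENNReal.ofReal (ρ * ν ρ)

lemma WhatPos.aemeasurable {ν : ℂ → ℝ} (h : WhatPos ν) :
    AEMeasurable (fun s : ℝ => ν s) (volume.restrict (Ioo 0 1)) :=
  h.intervalIntegrable.1.aestronglyMeasurable.aemeasurable.mono_measure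
    (Measure.restrict_mono Ioo_subset_Ioc_self le_rfl)

instance (ν : ℂ → ℝ) : SFinite (radMeas ν) := by unfold radMeas; infer_instance

lemma lintegral_UD_eq_polar {ν : ℂ → ℝ} (hν : RadialWeight ν) (hνp : WhatPos ν) {F : ℂ → ℝ≥0∞}
    (hF : Measurable F) :
    ∫⁻ z in UD, F z * ENNReal.ofReal (ν z) ∂dA = (ENNReal.ofReal Real.pi)⁻¹ *
      ∫⁻ θ in Ioo (-Real.pi) Real.pi, ∫⁻ ρ, F (ρ * Complex.exp (θ * Complex.I)) ∂radMeas ν := by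
  have hE (p : ℝ × ℝ) : Complex.polarCoord.symm p = p.1 * Complex.exp (p.2 * Complex.I) := by
    rw [Complex.polarCoord_symm_apply, Complex.exp_mul_I]
    push_cast
    ring
  rw [dA, Measure.restrict_smul, lintegral_smul_measure, smul_eq_mul]
  congr 1
  rw [← lintegral_indicator (show MeasurableSet UD from Metric.isOpen_ball.measurableSet),
    ← Complex.lintegral_comp_polarCoord_symm]
  have hmeas : Measurable fun p : ℝ × ℝ => F (p.1 * Complex.exp (p.2 * Complex.I)) :=
    hF.comp (by fun_prop)
  have hdens : AEMeasurable (fun ρ : ℝ => ENNReal.ofReal (ρ * ν ρ)) (volume.restrict (Ioo 0 1)) :=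
    (aemeasurable_id.mul hνp.aemeasurable).ennreal_ofReal
  have hrw : ∀ θ : ℝ, ∫⁻ ρ, F (ρ * Complex.exp (θ * Complex.I)) ∂radMeas ν =
      ∫⁻ ρ in Ioo (0 : ℝ) 1, ENNReal.ofReal (ρ * ν ρ) * F (ρ * Complex.exp (θ * Complex.I)) := by
    intro θ
    have hm : Measurable fun ρ : ℝ => F (ρ * Complex.exp (θ * Complex.I)) := hF.comp (by fun_prop)
    rw [radMeas, lintegral_withDensity_eq_lintegral_mul₀ hdens hm.aemeasurable]
    rfl
  simp_rw [hrw]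
  rw [← lintegral_prod_symm (μ := volume.restrict (Ioo (0 : ℝ) 1))
    (ν := volume.restrict (Ioo (-Real.pi) Real.pi))
    (fun p : ℝ × ℝ => ENNReal.ofReal (p.1 * ν p.1) * F (p.1 * Complex.exp (p.2 * Complex.I)))
    (hdens.comp_fst.mul hmeas.aemeasurable),
    Measure.prod_restrict, ← Measure.volume_eq_prod,
    ← lintegral_indicator (measurableSet_Ioo.prod measurableSet_Ioo),
    show polarCoord.target = Ioi 0 ×ˢ Ioo (-Real.pi) Real.pi from rfl,
    ← lintegral_indicator (measurableSet_Ioi.prod measurableSet_Ioo)]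
  refine lintegral_congr fun p => ?_
  simp only [indicator_apply, hE, mem_prod, mem_Ioi, mem_Ioo]
  have hn : ∀ h0 : 0 < p.1, ‖(p.1 : ℂ) * Complex.exp (p.2 * Complex.I)‖ = p.1 := by
    intro h0
    rw [norm_mul, Complex.norm_exp_ofReal_mul_I, Complex.norm_real, Real.norm_of_nonneg h0.le,
      mul_one]
  by_cases h0 : 0 < p.1
  · have hmem : (p.1 * Complex.exp (p.2 * Complex.I) ∈ UD) ↔ p.1 < 1 := by
      rw [UD, mem_ball_zero_iff, hn h0]
    have hv : ν (p.1 * Complex.exp (p.2 * Complex.I)) = ν p.1 := by rw [hν.2.1, hn h0]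
    by_cases h1 : p.1 < 1
    · by_cases h2 : -Real.pi < p.2 ∧ p.2 < Real.pi
      · simp only [h0, h1, h2, and_true, if_true, smul_eq_mul]
        rw [indicator_of_mem (hmem.2 h1), hv, ENNReal.ofReal_mul h0.le]
        ring
      · simp [h2]
    · rw [indicator_of_notMem (mt hmem.1 h1)]
      simp [h1]
  · simp [h0]

lemma ofReal_what_sub_le {ν : ℂ → ℝ} (h0 : ∀ z, 0 ≤ ν z) (hνp : WhatPos ν) {s t : ℝ}
    (hs : 1 / 2 ≤ s) (hst : s ≤ t) (ht : t < 1) :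
    ENNReal.ofReal ((what ν s - what ν t) / 2) ≤ radMeas ν (Ioc s t) := by
  have hI := hνp.intervalIntegrable_of_mem (a := s) (b := t) ⟨by linarith, by linarith⟩
    ⟨by linarith, by linarith⟩
  rw [what_sub_what hνp (by linarith) hst ht.le, ← intervalIntegral.integral_div,
    intervalIntegral.integral_of_le hst,
    ofReal_integral_eq_lintegral_ofReal (hI.1.div_const 2)
      (Filter.Eventually.of_forall fun _ => div_nonneg (h0 _) zero_le_two),
    radMeas, withDensity_apply _ measurableSet_Ioc,
    Measure.restrict_restrict measurableSet_Ioc, inter_eq_left.2]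
  · refine setLIntegral_mono' measurableSet_Ioc fun x hx => ENNReal.ofReal_le_ofReal ?_
    nlinarith [h0 x, hx.1]
  · exact fun x hx => ⟨by linarith [hx.1], by linarith [hx.2]⟩

lemma radMeas_Ici_le {ν : ℂ → ℝ} (h0 : ∀ z, 0 ≤ ν z) (hνp : WhatPos ν) {s : ℝ}
    (hs : 0 ≤ s) (hs1 : s ≤ 1) : radMeas ν (Ici s) ≤ ENNReal.ofReal (what ν s) := by
  have hI := hνp.intervalIntegrable_of_mem (a := s) (b := 1) ⟨hs, hs1⟩ ⟨zero_le_one, le_rfl⟩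
  rw [what, intervalIntegral.integral_of_le hs1, ← integral_Icc_eq_integral_Ioc,
    ofReal_integral_eq_lintegral_ofReal ((integrableOn_Icc_iff_integrableOn_Ioc (by simp)).2 hI.1)
      (Filter.Eventually.of_forall fun _ => h0 _),
    radMeas, withDensity_apply _ measurableSet_Ici,
    Measure.restrict_restrict measurableSet_Ici]
  refine (setLIntegral_mono' (measurableSet_Ici.inter measurableSet_Ioo)
    fun x hx => ENNReal.ofReal_le_ofReal ?_).trans
    (lintegral_mono_set (show Ici s ∩ Ioo 0 1 ⊆ Icc s 1 from fun x hx => ⟨hx.1, hx.2.2.le⟩))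
  nlinarith [h0 x, hx.2.1, hx.2.2]

lemma sum_inv_sq_le (n : ℕ) : ∑ j ∈ Finset.range n, 1 / ((j : ℝ) + 1) ^ 2 ≤ 2 - 2 / ((n : ℝ) + 1) := by
  induction n with
  | zero => norm_num
  | succ n ih =>
    rw [Finset.sum_range_succ]
    have : 1 / ((n : ℝ) + 1) ^ 2 ≤ 2 / (n + 1) - 2 / ((n + 1 : ℕ) + 1) := by
      push_cast
      rw [div_sub_div _ _ (by positivity) (by positivity),
        div_le_div_iff₀ (by positivity) (by positivity)]
      have : (0 : ℝ) ≤ n := n.cast_nonneg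
      ring_nf
      nlinarith [pow_nonneg this 3, pow_nonneg this 2]
    linarith

section Chaining

variable {G : ℝ → ℂ → ℝ≥0∞} {N A : ℝ≥0∞} {δ τ : ℝ} {c : ℝ → ℂ}

lemma edist_chain_le (hG : ∀ a, Measurable fun θ => G θ a)
    (h1 : ∀ θ a b, N * edist a b ≤ G θ a + G θ b)
    (hA : ∀ φ, ∫⁻ θ in Ioo (φ - δ) (φ + δ), G θ (c φ) ≤ A) (hτ : 0 < τ) (hτδ : τ < δ) (j : ℕ) :
    ENNReal.ofReal τ * (N * edist (c (j * τ)) (c 0)) ≤ 2 * j * A := by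
  induction j with
  | zero => simp
  | succ j ih =>
    have hstep : ENNReal.ofReal τ * (N * edist (c ((j + 1 : ℕ) * τ)) (c (j * τ))) ≤ 2 * A := by
      calc ENNReal.ofReal τ * (N * edist (c ((j + 1 : ℕ) * τ)) (c (j * τ)))
          = ∫⁻ θ in Ioo (j * τ) ((j + 1 : ℕ) * τ),
              N * edist (c ((j + 1 : ℕ) * τ)) (c (j * τ)) := by
            rw [setLIntegral_const, Real.volume_Ioo, mul_comm]
            congr 2
            push_cast
            ring
        _ ≤ ∫⁻ θ in Ioo (j * τ) ((j + 1 : ℕ) * τ),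
              (G θ (c ((j + 1 : ℕ) * τ)) + G θ (c (j * τ))) := lintegral_mono fun θ => h1 _ _ _
        _ = (∫⁻ θ in Ioo (j * τ) ((j + 1 : ℕ) * τ), G θ (c ((j + 1 : ℕ) * τ))) +
              ∫⁻ θ in Ioo (j * τ) ((j + 1 : ℕ) * τ), G θ (c (j * τ)) :=
            lintegral_add_left (hG _) _
        _ ≤ A + A := by
            refine add_le_add ((lintegral_mono_set ?_).trans (hA ((j + 1 : ℕ) * τ)))
              ((lintegral_mono_set ?_).trans (hA (j * τ))) <;>
            · apply Ioo_subset_Ioo <;> push_cast <;> linarith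
        _ = 2 * A := (two_mul A).symm
    calc ENNReal.ofReal τ * (N * edist (c ((j + 1 : ℕ) * τ)) (c 0))
        ≤ ENNReal.ofReal τ * (N * (edist (c ((j + 1 : ℕ) * τ)) (c (j * τ)) +
            edist (c (j * τ)) (c 0))) := by
          gcongr
          exact edist_triangle _ _ _
      _ = ENNReal.ofReal τ * (N * edist (c ((j + 1 : ℕ) * τ)) (c (j * τ))) +
            ENNReal.ofReal τ * (N * edist (c (j * τ)) (c 0)) := by ring
      _ ≤ 2 * A + 2 * j * A := add_le_add hstep ih
      _ = 2 * (j + 1 : ℕ) * A := by push_cast; ring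

lemma lintegral_chain_le (hG : ∀ a, Measurable fun θ => G θ a)
    (h1 : ∀ θ a b, N * edist a b ≤ G θ a + G θ b) (h2 : ∀ θ a b, G θ a ≤ G θ b + N * edist b a)
    (hA : ∀ φ, ∫⁻ θ in Ioo (φ - δ) (φ + δ), G θ (c φ) ≤ A) (hτ : 0 < τ) (hτδ : τ < δ) (j : ℕ) :
    ∫⁻ θ in Ioc (j * τ) ((j + 1 : ℕ) * τ), G θ (c 0) ≤ (2 * j + 1) * A := by
  calc ∫⁻ θ in Ioc (j * τ) ((j + 1 : ℕ) * τ), G θ (c 0)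
      ≤ ∫⁻ θ in Ioc (j * τ) ((j + 1 : ℕ) * τ), (G θ (c (j * τ)) + N * edist (c (j * τ)) (c 0)) :=
        lintegral_mono fun θ => h2 _ _ _
    _ = (∫⁻ θ in Ioc (j * τ) ((j + 1 : ℕ) * τ), G θ (c (j * τ))) +
          ENNReal.ofReal τ * (N * edist (c (j * τ)) (c 0)) := by
        rw [lintegral_add_left (hG _), setLIntegral_const, Real.volume_Ioc,
          mul_comm (N * edist (c (j * τ)) (c 0))]
        congr 3
        push_cast
        ring
    _ ≤ A + 2 * j * A := by
        refine add_le_add ((lintegral_mono_set ?_).trans (hA (j * τ)))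
          (edist_chain_le hG h1 hA hτ hτδ j)
        intro θ hθ
        constructor
        · linarith [hθ.1]
        · have := hθ.2
          push_cast at this
          linarith
    _ = (2 * j + 1) * A := by ring

lemma Ioc_subset_iUnion_Ioc_nat_mul (τ : ℝ) (n : ℕ) :
    Ioc 0 (n * τ) ⊆ ⋃ j ∈ Finset.range n, Ioc (j * τ) ((j + 1 : ℕ) * τ) := by
  induction n with
  | zero => simp
  | succ n ih =>
    intro θ hθ
    by_cases h : θ ≤ n * τ
    · obtain ⟨j, hj, hmem⟩ := mem_iUnion₂.1 (ih ⟨hθ.1, h⟩)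
      exact mem_iUnion₂.2 ⟨j, Finset.mem_range.2 ((Finset.mem_range.1 hj).trans n.lt_succ_self),
        hmem⟩
    · exact mem_iUnion₂.2 ⟨n, Finset.self_mem_range_succ n, not_le.1 h, hθ.2⟩

lemma setLIntegral_biUnion_finset_le {α ι : Type*} [MeasurableSpace α] {μ : Measure α}
    (s : Finset ι) (t : ι → Set α) (f : α → ℝ≥0∞) :
    ∫⁻ x in ⋃ i ∈ s, t i, f x ∂μ ≤ ∑ i ∈ s, ∫⁻ x in t i, f x ∂μ := by
  classical
  induction s using Finset.induction_on with
  | empty => simp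
  | insert i s hi ih =>
    rw [Finset.set_biUnion_insert, Finset.sum_insert hi]
    exact (lintegral_union_le _ _ _).trans (by gcongr)

/-- A decaying kernel turns local mean oscillation bounds into a global one. -/
lemma lintegral_mul_chain_le (hG : ∀ a, Measurable fun θ => G θ a)
    (h1 : ∀ θ a b, N * edist a b ≤ G θ a + G θ b) (h2 : ∀ θ a b, G θ a ≤ G θ b + N * edist b a)
    (hA : ∀ φ, ∫⁻ θ in Ioo (φ - δ) (φ + δ), G θ (c φ) ≤ A) (hδ : 0 < δ) (hδ1 : δ ≤ 1) :
    ∫⁻ θ in Ioc 0 Real.pi, ENNReal.ofReal ((max δ (|θ| / Real.pi))⁻¹ ^ 3) * G θ (c 0) ≤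
      ENNReal.ofReal (4 * (4 * Real.pi / δ) ^ 3) * A := by
  have hπ := Real.pi_pos
  have hπ3 := Real.pi_gt_three
  obtain ⟨n, hn⟩ : ∃ n : ℕ, n = ⌈Real.pi / δ⌉₊ + 1 := ⟨_, rfl⟩
  have hn1 : Real.pi / δ < n := by
    rw [hn]; push_cast; linarith [Nat.le_ceil (Real.pi / δ)]
  have hn2 : (n : ℝ) ≤ Real.pi / δ + 2 := by
    rw [hn]; push_cast; linarith [Nat.ceil_lt_add_one (a := Real.pi / δ) (by positivity)]
  have hn0 : (0 : ℝ) < n := lt_trans (by positivity) hn1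
  set τ := Real.pi / n with hτdef
  have hτ : 0 < τ := by positivity
  have hτδ : τ < δ := by
    rw [div_lt_iff₀ hδ] at hn1
    rw [hτdef, div_lt_iff₀ hn0]
    linarith
  have hδτ : δ / 2 ≤ τ := by
    rw [hτdef, le_div_iff₀ hn0]
    have : δ * n ≤ Real.pi + 2 * δ := by
      calc δ * n ≤ δ * (Real.pi / δ + 2) := by gcongr
        _ = Real.pi + 2 * δ := by field_simp
    linarith
  have hcov : Ioc 0 Real.pi ⊆ ⋃ j ∈ Finset.range n, Ioc (j * τ) ((j + 1 : ℕ) * τ) := by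
    have := Ioc_subset_iUnion_Ioc_nat_mul τ n
    rwa [hτdef, mul_div_cancel₀ _ hn0.ne'] at this
  set K := 4 * Real.pi / δ with hK
  have hK0 : 0 < K := by positivity
  have hW (j : ℕ) (θ : ℝ) (hθ : θ ∈ Ioc (j * τ) ((j + 1 : ℕ) * τ)) :
      (max δ (|θ| / Real.pi))⁻¹ ^ 3 ≤ (K / (j + 1)) ^ 3 := by
    have hj0 : (0 : ℝ) ≤ j := j.cast_nonneg
    have hθ0 : 0 ≤ θ := (mul_nonneg hj0 hτ.le).trans hθ.1.le
    refine pow_le_pow_left₀ (inv_nonneg.2 (le_max_of_le_left hδ.le)) ?_ 3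
    rw [inv_le_comm₀ (lt_max_of_lt_left hδ) (by positivity), hK, inv_div, div_div_eq_mul_div,
      div_le_iff₀ (by positivity)]
    rcases j.eq_zero_or_pos with h | h
    · subst h
      have := le_max_left δ (|θ| / Real.pi)
      push_cast
      nlinarith
    · have hj1 : (1 : ℝ) ≤ j := by exact_mod_cast h
      have h3 : |θ| ≤ max δ (|θ| / Real.pi) * Real.pi :=
        (div_le_iff₀ hπ).1 (le_max_right _ _)
      rw [abs_of_nonneg hθ0] at h3 ⊢
      have h4 : (j : ℝ) * (δ / 2) ≤ θ := (mul_le_mul_of_nonneg_left hδτ hj0).trans hθ.1.le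
      nlinarith
  calc ∫⁻ θ in Ioc 0 Real.pi, ENNReal.ofReal ((max δ (|θ| / Real.pi))⁻¹ ^ 3) * G θ (c 0)
      ≤ ∑ j ∈ Finset.range n, ∫⁻ θ in Ioc (j * τ) ((j + 1 : ℕ) * τ),
          ENNReal.ofReal ((max δ (|θ| / Real.pi))⁻¹ ^ 3) * G θ (c 0) :=
        (lintegral_mono_set hcov).trans (setLIntegral_biUnion_finset_le _ _ _)
    _ ≤ ∑ j ∈ Finset.range n, ENNReal.ofReal (2 * K ^ 3 * (1 / ((j : ℝ) + 1) ^ 2)) * A := by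
        refine Finset.sum_le_sum fun j _ => ?_
        calc ∫⁻ θ in Ioc (j * τ) ((j + 1 : ℕ) * τ),
              ENNReal.ofReal ((max δ (|θ| / Real.pi))⁻¹ ^ 3) * G θ (c 0)
            ≤ ∫⁻ θ in Ioc (j * τ) ((j + 1 : ℕ) * τ),
              ENNReal.ofReal ((K / (j + 1)) ^ 3) * G θ (c 0) := by
              refine setLIntegral_mono' measurableSet_Ioc fun θ hθ => ?_
              exact mul_le_mul' (ENNReal.ofReal_le_ofReal (hW j θ hθ)) le_rfl
          _ = ENNReal.ofReal ((K / (j + 1)) ^ 3) *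
                ∫⁻ θ in Ioc (j * τ) ((j + 1 : ℕ) * τ), G θ (c 0) := lintegral_const_mul _ (hG _)
          _ ≤ ENNReal.ofReal ((K / (j + 1)) ^ 3) * ((2 * j + 1) * A) := by
              gcongr
              exact lintegral_chain_le hG h1 h2 hA hτ hτδ j
          _ = ENNReal.ofReal ((K / (j + 1)) ^ 3 * (2 * j + 1)) * A := by
              rw [ENNReal.ofReal_mul (by positivity), ← mul_assoc]
              congr 2
              rw [ENNReal.ofReal_add (by positivity) zero_le_one,
                ENNReal.ofReal_mul zero_le_two]
              simp
          _ ≤ ENNReal.ofReal (2 * K ^ 3 * (1 / ((j : ℝ) + 1) ^ 2)) * A := by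
              refine mul_le_mul' (ENNReal.ofReal_le_ofReal ?_) le_rfl
              rw [div_pow, div_mul_eq_mul_div, mul_one_div,
                div_le_div_iff₀ (by positivity) (by positivity)]
              have : 0 ≤ K ^ 3 * ((j : ℝ) + 1) ^ 2 := by positivity
              nlinarith
    _ = ENNReal.ofReal (∑ j ∈ Finset.range n, 2 * K ^ 3 * (1 / ((j : ℝ) + 1) ^ 2)) * A := by
        rw [ENNReal.ofReal_sum_of_nonneg fun _ _ => by positivity, Finset.sum_mul]
    _ ≤ ENNReal.ofReal (4 * K ^ 3) * A := by
        gcongr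
        rw [← Finset.mul_sum]
        have h5 := sum_inv_sq_le n
        have h6 : 0 ≤ 2 / ((n : ℝ) + 1) := by positivity
        have : 0 < K ^ 3 := by positivity
        nlinarith

end Chaining

lemma setLIntegral_comp_neg {s : Set ℝ} (F : ℝ → ℝ≥0∞) :
    ∫⁻ θ in Neg.neg ⁻¹' s, F (-θ) = ∫⁻ θ in s, F θ :=
  (Measure.measurePreserving_neg (volume : Measure ℝ)).setLIntegral_comp_preimage_emb
    (MeasurableEquiv.neg ℝ).measurableEmbedding F s

lemma enorm_circleAverage_le {E : Type*} [NormedAddCommGroup E] [NormedSpace ℝ E]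
    (F : ℂ → E) (ρ : ℝ) :
    ‖Real.circleAverage F 0 ρ‖ₑ ≤ ENNReal.ofReal (2 * Real.pi)⁻¹ *
      ∫⁻ θ in Ioc (-Real.pi) Real.pi, ‖F (ρ * Complex.exp (θ * Complex.I))‖ₑ := by
  have hπ := Real.pi_pos
  rw [Real.circleAverage_eq_integral_add (-Real.pi),
    intervalIntegral.integral_comp_add_right (fun θ => F (circleMap 0 ρ θ)), enorm_smul,
    Real.enorm_of_nonneg (by positivity), intervalIntegral.integral_of_le (by linarith)]
  gcongr
  refine (enorm_integral_le_lintegral_enorm _).trans (le_of_eq ?_)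
  simp only [circleMap, zero_add]
  rw [show 2 * Real.pi + -Real.pi = Real.pi by ring]

lemma enorm_sub_le_lintegral_circle {f : ℂ → ℂ} (hf : DifferentiableOn ℂ f UD) {R ρ : ℝ}
    (hR0 : 0 ≤ R) (hR1 : R < 1) (hρ : ρ ∈ Ico (1 - (1 - R) / 2) 1) {w : ℂ}
    (hw : ‖w - R‖ ≤ (1 - R) / 4) (a : ℂ) :
    ‖f w - a‖ₑ ≤ ENNReal.ofReal (54 * (1 - R) ^ 2) * ∫⁻ θ in Ioc (-Real.pi) Real.pi,
      ENNReal.ofReal ((max (1 - R) (|θ| / Real.pi))⁻¹ ^ 3) *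
        ‖f (ρ * Complex.exp (θ * Complex.I)) - a‖ₑ := by
  obtain ⟨hρ0, hρ1⟩ := hρ
  have hπ3 := Real.pi_gt_three
  set δ := 1 - R with hδdef
  have hδ : 0 < δ := by linarith
  have hδ1 : δ ≤ 1 := by linarith
  have hρp : 0 < ρ := by linarith
  have hRn : ‖(R : ℂ)‖ = R := by rw [Complex.norm_real, Real.norm_of_nonneg hR0]
  have hwn : ‖w‖ ≤ R + δ / 4 := by
    calc ‖w‖ = ‖(R : ℂ) + (w - R)‖ := by congr 1; ring
      _ ≤ _ := (norm_add_le _ _).trans (by rw [hRn]; linarith)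
  have hlow (ζ : ℂ) (hζ : ‖ζ‖ ≤ 1) : δ ≤ ‖1 - R * ζ‖ := by
    have := norm_sub_norm_le (1 : ℂ) (R * ζ)
    rw [norm_mul, hRn, norm_one] at this
    nlinarith
  have hne (ζ : ℂ) (hζ : ‖ζ‖ ≤ 1) : 1 - R * ζ ≠ 0 := by
    rw [← norm_pos_iff]; exact hδ.trans_le (hlow ζ hζ)
  have hup : ‖1 - R * w‖ ≤ 3 * δ := by
    have : 1 - R * w = ((1 - R ^ 2 : ℝ) : ℂ) - R * (w - R) := by push_cast; ring
    rw [this]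
    refine (norm_sub_le _ _).trans ?_
    rw [norm_mul, hRn, Complex.norm_real, Real.norm_of_nonneg (by nlinarith)]
    nlinarith
  let g : ℂ → ℂ := fun ζ => (f ζ - a) * ((1 - R * w) / (1 - R * ζ)) ^ 3
  have hg : DiffContOnCl ℂ g (Metric.ball 0 |ρ|) := by
    refine DifferentiableOn.diffContOnCl ?_
    rw [abs_of_pos hρp, closure_ball _ hρp.ne']
    have hsub : Metric.closedBall (0 : ℂ) ρ ⊆ UD := Metric.closedBall_subset_ball hρ1
    refine ((hf.mono hsub).sub_const a).mul (DifferentiableOn.pow (DifferentiableOn.div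
      (by fun_prop) (by fun_prop) fun ζ hζ => hne ζ ?_) 3)
    exact (mem_closedBall_zero_iff.1 hζ).trans hρ1.le
  have hgw : g w = f w - a := by
    simp only [g]
    rw [div_self (hne w (by linarith)), one_pow, mul_one]
  have hmv := hg.circleAverage_smul_div (w := w)
    (by rw [mem_ball_zero_iff, abs_of_pos hρp]; linarith)
  rw [← hgw, ← hmv]
  refine (enorm_circleAverage_le _ ρ).trans ?_
  have hcoef : ENNReal.ofReal (54 * δ ^ 2) =
      ENNReal.ofReal (1 / 2) * ENNReal.ofReal (108 * δ ^ 2) := by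
    rw [← ENNReal.ofReal_mul (by norm_num)]; congr 1; ring
  rw [hcoef, mul_assoc]
  refine mul_le_mul' (ENNReal.ofReal_le_ofReal ?_) ?_
  · rw [one_div]; exact inv_anti₀ two_pos (by linarith)
  rw [← lintegral_const_mul' _ _ ENNReal.ofReal_ne_top]
  refine setLIntegral_mono' measurableSet_Ioc fun θ hθ => ?_
  set ζ := (ρ : ℂ) * Complex.exp (θ * Complex.I) with hζdef
  have hζn : ‖ζ‖ = ρ := by
    rw [hζdef, norm_mul, Complex.norm_exp_ofReal_mul_I, Complex.norm_real,
      Real.norm_of_nonneg hρp.le, mul_one]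
  have hmax : max δ (|θ| / Real.pi) ≤ ‖1 - R * ζ‖ := by
    refine max_le (hlow ζ (hζn.trans_le hρ1.le)) ?_
    rw [div_le_iff₀ Real.pi_pos, mul_comm]
    have := abs_le_norm_one_sub_exp (x := R * ρ) (θ := θ) (by positivity) (by nlinarith)
      (abs_le.2 ⟨hθ.1.le, hθ.2⟩)
    rwa [Complex.ofReal_mul, mul_assoc] at this
  have hmax0 : 0 < max δ (|θ| / Real.pi) := lt_max_of_lt_left hδ
  have hζw : δ / 4 ≤ ‖ζ - w‖ := by
    have := norm_sub_norm_le ζ w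
    linarith
  rw [← ofReal_norm (f ζ - a), ← ENNReal.ofReal_mul (by positivity),
    ← ENNReal.ofReal_mul (by positivity), ← ofReal_norm]
  refine ENNReal.ofReal_le_ofReal ?_
  simp only [g, smul_eq_mul, sub_zero, norm_mul, norm_div, norm_pow, hζn]
  have hA : ρ / ‖ζ - w‖ ≤ 4 / δ := by
    rw [div_le_div_iff₀ (by linarith) hδ]
    nlinarith
  have hB : ‖1 - R * w‖ / ‖1 - R * ζ‖ ≤ 3 * δ * (max δ (|θ| / Real.pi))⁻¹ := by
    rw [div_eq_mul_inv]
    gcongr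
  calc ρ / ‖ζ - w‖ * (‖f ζ - a‖ * (‖1 - R * w‖ / ‖1 - R * ζ‖) ^ 3)
      ≤ 4 / δ * (‖f ζ - a‖ * (3 * δ * (max δ (|θ| / Real.pi))⁻¹) ^ 3) := by gcongr
    _ = 108 * δ ^ 2 * ((max δ (|θ| / Real.pi))⁻¹ ^ 3 * ‖f ζ - a‖) := by
      field_simp
      ring

/-- If the oscillation of `f` over each of the polar rectangles of angular size `1 - R` is at most
`A`, then the derivative of `f` at `R` is controlled by `A`. -/
lemma norm_deriv_le_of_oscillation {κ : Measure ℝ} [SFinite κ] {f : ℂ → ℂ}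
    (hf : DifferentiableOn ℂ f UD) (hfm : Measurable f) {R : ℝ} (hR0 : 0 ≤ R) (hR1 : R < 1)
    (hκ : ∀ᵐ ρ ∂κ, ρ ∈ Ico (1 - (1 - R) / 2) 1) {A m : ℝ} (hA0 : 0 ≤ A) (hm0 : 0 < m)
    (hm : ENNReal.ofReal m ≤ κ univ) {c : ℝ → ℂ}
    (hA : ∀ φ, ∫⁻ θ in Ioo (φ - (1 - R)) (φ + (1 - R)),
      ∫⁻ ρ, ‖f (ρ * Complex.exp (θ * Complex.I)) - c φ‖ₑ ∂κ ≤ ENNReal.ofReal A) :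
    ‖deriv f R‖ ≤ 110592 * Real.pi ^ 3 * A / ((1 - R) ^ 2 * m) := by
  set δ := 1 - R with hδdef
  have hδ : 0 < δ := by linarith
  have hδ1 : δ ≤ 1 := by linarith
  have hπ := Real.pi_pos
  let G : ℝ → ℂ → ℝ≥0∞ := fun θ a => ∫⁻ ρ, ‖f (ρ * Complex.exp (θ * Complex.I)) - a‖ₑ ∂κ
  have hjoint (a : ℂ) :
      Measurable fun p : ℝ × ℝ => ‖f (p.2 * Complex.exp (p.1 * Complex.I)) - a‖ₑ :=
    ((hfm.comp (by fun_prop)).sub_const a).enorm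
  have hG (a : ℂ) : Measurable fun θ => G θ a := (hjoint a).lintegral_prod_right'
  have hρm (θ : ℝ) (a : ℂ) : Measurable fun ρ : ℝ => ‖f (ρ * Complex.exp (θ * Complex.I)) - a‖ₑ :=
    ((hfm.comp (by fun_prop)).sub_const a).enorm
  have h1 (θ : ℝ) (a b : ℂ) : κ univ * edist a b ≤ G θ a + G θ b := by
    rw [mul_comm, ← lintegral_const, ← lintegral_add_left (hρm θ a)]
    refine lintegral_mono fun ρ => ?_
    rw [← edist_eq_enorm_sub, ← edist_eq_enorm_sub, edist_comm _ a]
    exact edist_triangle _ _ _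
  have h2 (θ : ℝ) (a b : ℂ) : G θ a ≤ G θ b + κ univ * edist b a := by
    rw [mul_comm, ← lintegral_const, ← lintegral_add_left (hρm θ b)]
    refine lintegral_mono fun ρ => ?_
    rw [← edist_eq_enorm_sub, ← edist_eq_enorm_sub]
    exact edist_triangle _ _ _
  let W : ℝ → ℝ≥0∞ := fun θ => ENNReal.ofReal ((max δ (|θ| / Real.pi))⁻¹ ^ 3)
  have hWm : Measurable W := by fun_prop
  set B := ENNReal.ofReal (4 * (4 * Real.pi / δ) ^ 3) * ENNReal.ofReal A with hB
  have hpos : ∫⁻ θ in Ioc 0 Real.pi, W θ * G θ (c 0) ≤ B :=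
    lintegral_mul_chain_le hG h1 h2 hA hδ hδ1
  have hneg : ∫⁻ θ in Ioc (-Real.pi) 0, W θ * G θ (c 0) ≤ B := by
    have := lintegral_mul_chain_le (G := fun θ a => G (-θ) a) (c := fun φ => c (-φ))
      (N := κ univ) (A := ENNReal.ofReal A) (δ := δ) (fun a => (hG a).comp measurable_neg)
      (fun θ => h1 (-θ)) (fun θ => h2 (-θ)) (fun φ => by
        rw [← setLIntegral_comp_neg (fun θ => G (-θ) (c (-φ)))]
        simpa [G, neg_sub, sub_eq_add_neg, add_comm] using hA (-φ)) hδ hδ1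
    rw [neg_zero] at this
    refine le_trans (le_of_eq ?_) this
    rw [← setLIntegral_comp_neg, ← setLIntegral_congr Ioo_ae_eq_Ioc]
    simp only [neg_preimage, neg_Ioc, neg_zero, neg_neg]
    rw [← setLIntegral_congr Ioo_ae_eq_Ico]
    simp [W]
  have htot : ∫⁻ θ in Ioc (-Real.pi) Real.pi, W θ * G θ (c 0) ≤ 2 * B := by
    rw [← Ioc_union_Ioc_eq_Ioc (neg_nonpos.2 hπ.le) hπ.le, two_mul]
    exact (lintegral_union_le _ _ _).trans (add_le_add hneg hpos)
  have hbound (w : ℂ) (hw : ‖w - R‖ ≤ δ / 4) :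
      ‖f w - c 0‖ ≤ 27648 * Real.pi ^ 3 * A / (δ * m) := by
    have hE : ‖f w - c 0‖ₑ * κ univ ≤ ENNReal.ofReal (54 * δ ^ 2) * (2 * B) := by
      calc ‖f w - c 0‖ₑ * κ univ = ∫⁻ _, ‖f w - c 0‖ₑ ∂κ := by rw [lintegral_const]
        _ ≤ ∫⁻ ρ : ℝ, ENNReal.ofReal (54 * δ ^ 2) *
            (∫⁻ θ in Ioc (-Real.pi) Real.pi,
              W θ * ‖f (ρ * Complex.exp (θ * Complex.I)) - c 0‖ₑ) ∂κ := by
          refine lintegral_mono_ae ?_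
          filter_upwards [hκ] with ρ hρ
          exact enorm_sub_le_lintegral_circle hf hR0 hR1 hρ hw (c 0)
        _ = ENNReal.ofReal (54 * δ ^ 2) * ∫⁻ θ in Ioc (-Real.pi) Real.pi, W θ * G θ (c 0) := by
          rw [lintegral_const_mul' _ _ ENNReal.ofReal_ne_top, lintegral_lintegral_swap]
          · congr 1
            exact lintegral_congr fun θ => lintegral_const_mul _ (hρm θ (c 0))
          · exact ((hWm.comp measurable_snd).mul
              ((hjoint (c 0)).comp measurable_swap)).aemeasurable
        _ ≤ _ := by gcongr
    have hE2 : ENNReal.ofReal (‖f w - c 0‖ * m) ≤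
        ENNReal.ofReal (54 * δ ^ 2 * (2 * (4 * (4 * Real.pi / δ) ^ 3 * A))) := by
      have hEB : ENNReal.ofReal (54 * δ ^ 2 * (2 * (4 * (4 * Real.pi / δ) ^ 3 * A))) =
          ENNReal.ofReal (54 * δ ^ 2) * (2 * B) := by
        rw [hB, ← ENNReal.ofReal_mul (by positivity), ← ENNReal.ofReal_ofNat 2,
          ← ENNReal.ofReal_mul zero_le_two, ← ENNReal.ofReal_mul (by positivity)]
      rw [hEB, ENNReal.ofReal_mul (norm_nonneg _), ofReal_norm]
      exact (mul_le_mul' le_rfl hm).trans hE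
    rw [ENNReal.ofReal_le_ofReal_iff (by positivity)] at hE2
    rw [le_div_iff₀ (by positivity)]
    calc ‖f w - c 0‖ * (δ * m) = ‖f w - c 0‖ * m * δ := by ring
      _ ≤ 54 * δ ^ 2 * (2 * (4 * (4 * Real.pi / δ) ^ 3 * A)) * δ := by gcongr
      _ = _ := by field_simp; ring
  have hsub : Metric.closedBall (R : ℂ) (δ / 4) ⊆ UD := by
    intro w hw
    rw [mem_closedBall_iff_norm] at hw
    rw [mem_UD]
    calc ‖w‖ = ‖(R : ℂ) + (w - R)‖ := by congr 1; ring
      _ ≤ ‖(R : ℂ)‖ + ‖w - R‖ := norm_add_le _ _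
      _ < 1 := by rw [Complex.norm_real, Real.norm_of_nonneg hR0]; linarith
  have hd : DiffContOnCl ℂ (fun w => f w - c 0) (Metric.ball (R : ℂ) (δ / 4)) := by
    refine DifferentiableOn.diffContOnCl ?_
    rw [closure_ball _ (by positivity)]
    exact (hf.mono hsub).sub_const _
  have := Complex.norm_deriv_le_of_forall_mem_sphere_norm_le (by positivity) hd
    fun w hw => hbound w (mem_sphere_iff_norm.1 hw).le
  rw [deriv_sub_const] at this
  refine this.trans (le_of_eq ?_)
  field_simp
  ring

lemma norm_ofReal_mul_exp {ρ : ℝ} (hρ : 0 ≤ ρ) (θ : ℝ) :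
    ‖(ρ : ℂ) * Complex.exp (θ * Complex.I)‖ = ρ := by
  rw [norm_mul, Complex.norm_exp_ofReal_mul_I, mul_one, Complex.norm_real, Real.norm_of_nonneg hρ]

lemma ofReal_mem_UD {R : ℝ} (hR0 : 0 ≤ R) (hR1 : R < 1) : (R : ℂ) ∈ UD := by
  rwa [mem_UD, Complex.norm_real, Real.norm_of_nonneg hR0]

/-- A polar rectangle contained in a large hyperbolic disc. -/
lemma polar_mem_hDisc {R K r ρ θ : ℝ} (hR0 : 0 ≤ R) (hR1 : R < 1) (hK : 1 < K)
    (hr : 72 * K ≤ r) (hρ : ρ ∈ Ioc (1 - (1 - R) / 2) (1 - (1 - R) / K / 2))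
    (hθ : |θ| ≤ 1 - R) : (ρ : ℂ) * Complex.exp (θ * Complex.I) ∈ hDisc R r := by
  obtain ⟨hρ1, hρ2⟩ := hρ
  have hδK : 0 < (1 - R) / K := div_pos (by linarith) (by linarith)
  have hρ0 : 0 ≤ ρ := by linarith
  have hn := norm_ofReal_mul_exp hρ0 θ
  have hRn : ‖(R : ℂ)‖ = R := by rw [Complex.norm_real, Real.norm_of_nonneg hR0]
  have hup : ‖1 - conj (R : ℂ) * (ρ * Complex.exp (θ * Complex.I))‖ ≤ 3 * (1 - R) := by
    have h1 : 1 - conj (R : ℂ) * (ρ * Complex.exp (θ * Complex.I)) =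
        ((1 - R * ρ : ℝ) : ℂ) - ((R * ρ : ℝ) : ℂ) * (Complex.exp (Complex.I * θ) - 1) := by
      rw [Complex.conj_ofReal, mul_comm Complex.I]
      push_cast
      ring
    have h2 : ‖Complex.exp (Complex.I * θ) - 1‖ ≤ 1 - R :=
      Real.norm_exp_I_mul_ofReal_sub_one_le.trans hθ
    rw [h1]
    refine (norm_sub_le _ _).trans ?_
    rw [norm_mul, Complex.norm_real, Complex.norm_real, Real.norm_of_nonneg (by nlinarith),
      Real.norm_of_nonneg (by positivity)]
    nlinarith [mul_le_mul_of_nonneg_right (show R * ρ ≤ 1 by nlinarith) (norm_nonneg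
      (Complex.exp (Complex.I * θ) - 1))]
  refine mem_hDisc_of_norm_one_sub_le (b := 1 / (18 * K)) (ofReal_mem_UD hR0 hR1)
    (by rw [mem_UD, hn]; linarith) (by positivity) ?_ ?_
  · have := Real.add_one_le_exp (2 * r)
    rw [one_div_mul_eq_div, lt_div_iff₀ (by positivity)]
    linarith
  · rw [hn, hRn]
    calc 1 / (18 * K) * ‖1 - conj (R : ℂ) * (ρ * Complex.exp (θ * Complex.I))‖ ^ 2
        ≤ 1 / (18 * K) * (3 * (1 - R)) ^ 2 := by gcongr
      _ = (1 - R) * ((1 - R) / K / 2) := by field_simp; ring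
      _ ≤ (1 - R ^ 2) * (1 - ρ ^ 2) := by
        apply mul_le_mul <;> nlinarith

lemma mul_mem_hDisc_iff {u : ℂ} (hu : ‖u‖ = 1) (z ζ : ℂ) (r : ℝ) :
    u * ζ ∈ hDisc (u * z) r ↔ ζ ∈ hDisc z r := by
  have huu : conj u * u = 1 := by
    rw [mul_comm, Complex.mul_conj, Complex.normSq_eq_norm_sq, hu]; norm_num
  have hpd : pd (u * z) (u * ζ) = pd z ζ := by
    rw [pd, pd, ← mul_sub, map_mul, show conj u * conj z * (u * ζ) = conj u * u * (conj z * ζ) by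
      ring, huu, one_mul, norm_div, norm_mul, hu, one_mul, norm_div]
  simp only [hDisc, mem_ofPred_eq, hyp, hpd, mem_UD, norm_mul, hu, one_mul]

lemma setLIntegral_hDisc_mul {u : ℂ} (hu : ‖u‖ = 1) (z : ℂ) (r : ℝ) (F : ℂ → ℝ≥0∞) :
    ∫⁻ ζ in hDisc (u * z) r, F ζ ∂dA = ∫⁻ ζ in hDisc z r, F (u * ζ) ∂dA := by
  let a : Circle := ⟨u, mem_sphere_zero_iff_norm.2 hu⟩
  have hmp : MeasurePreserving (rotation a) dA dA :=
    (rotation a).measurePreserving.smul_measure _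
  have := hmp.setLIntegral_comp_preimage_emb
    (rotation a).toHomeomorph.measurableEmbedding F (hDisc (u * z) r)
  rw [← this]
  have hpre : rotation a ⁻¹' hDisc (u * z) r = hDisc z r := by
    ext ζ
    simpa only [mem_preimage, rotation_apply] using mul_mem_hDisc_iff hu z ζ r
  rw [hpre]
  rfl

lemma RadialWeight.mul_eq {ν : ℂ → ℝ} (hν : RadialWeight ν) {u : ℂ} (hu : ‖u‖ = 1) (z : ℂ) :
    ν (u * z) = ν z := by
  rw [hν.2.1 (u * z), hν.2.1 z, norm_mul, hu, one_mul]

lemma setLIntegral_hDisc_eq_polar {ν : ℂ → ℝ} (hν : RadialWeight ν) (hνp : WhatPos ν)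
    {F : ℂ → ℝ≥0∞} (hF : Measurable F) (z : ℂ) (r : ℝ) :
    ∫⁻ ζ in hDisc z r, F ζ * ENNReal.ofReal (ν ζ) ∂dA = (ENNReal.ofReal Real.pi)⁻¹ *
      ∫⁻ θ in Ioo (-Real.pi) Real.pi, ∫⁻ ρ, (hDisc z r).indicator F
        (ρ * Complex.exp (θ * Complex.I)) ∂radMeas ν := by
  rw [← lintegral_UD_eq_polar hν hνp (hF.indicator (measurableSet_hDisc z r)),
    ← inter_eq_left.2 (hDisc_subset_UD z r), ← Measure.restrict_restrict (measurableSet_hDisc z r),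
    ← lintegral_indicator (measurableSet_hDisc z r), inter_eq_left.2 (hDisc_subset_UD z r)]
  simp only [indicator_mul_left]

lemma lintegral_rect_le {ν : ℂ → ℝ} (hν : RadialWeight ν) (hνp : WhatPos ν) {F : ℂ → ℝ≥0∞}
    (hF : Measurable F) {R K r : ℝ} (hR0 : 0 ≤ R) (hR1 : R < 1) (hK : 1 < K) (hr : 72 * K ≤ r) :
    ∫⁻ θ in Ioo (-(1 - R)) (1 - R), ∫⁻ ρ, F (ρ * Complex.exp (θ * Complex.I))
        ∂(radMeas ν).restrict (Ioc (1 - (1 - R) / 2) (1 - (1 - R) / K / 2)) ≤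
      ENNReal.ofReal Real.pi * ∫⁻ ζ in hDisc R r, F ζ * ENNReal.ofReal (ν ζ) ∂dA := by
  have hπ := Real.pi_gt_three
  rw [setLIntegral_hDisc_eq_polar hν hνp hF, ← mul_assoc, ENNReal.mul_inv_cancel
    (by simpa using Real.pi_pos) ENNReal.ofReal_ne_top, one_mul]
  refine le_trans ?_ (lintegral_mono_set (Ioo_subset_Ioo (a₁ := -(1 - R)) (a₂ := -Real.pi)
    (b₁ := 1 - R) (b₂ := Real.pi) (by linarith) (by linarith)))
  refine setLIntegral_mono' measurableSet_Ioo fun θ hθ => ?_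
  refine le_trans ?_ (setLIntegral_le_lintegral
    (Ioc (1 - (1 - R) / 2) (1 - (1 - R) / K / 2)) _)
  refine setLIntegral_mono' measurableSet_Ioc fun ρ hρ => ?_
  rw [indicator_of_mem (polar_mem_hDisc hR0 hR1 hK hr hρ (abs_le.2 ⟨hθ.1.le, hθ.2.le⟩))]

lemma lintegral_rect_rotate_le {ν : ℂ → ℝ} (hν : RadialWeight ν) (hνp : WhatPos ν)
    {F : ℂ → ℝ≥0∞} (hF : Measurable F) {R K r : ℝ} (hR0 : 0 ≤ R) (hR1 : R < 1) (hK : 1 < K)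
    (hr : 72 * K ≤ r) (φ : ℝ) :
    ∫⁻ θ in Ioo (φ - (1 - R)) (φ + (1 - R)), ∫⁻ ρ, F (ρ * Complex.exp (θ * Complex.I))
        ∂(radMeas ν).restrict (Ioc (1 - (1 - R) / 2) (1 - (1 - R) / K / 2)) ≤
      ENNReal.ofReal Real.pi *
        ∫⁻ ζ in hDisc (Complex.exp (φ * Complex.I) * R) r, F ζ * ENNReal.ofReal (ν ζ) ∂dA := by
  have hu := Complex.norm_exp_ofReal_mul_I φ
  rw [setLIntegral_hDisc_mul hu]
  simp only [hν.mul_eq hu]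
  refine le_trans (le_of_eq ?_) (lintegral_rect_le hν hνp
    (hF.comp (measurable_const_mul (Complex.exp (φ * Complex.I)))) hR0 hR1 hK hr)
  rw [← (measurePreserving_add_right (volume : Measure ℝ) φ).setLIntegral_comp_preimage_emb
    (measurableEmbedding_addRight φ)]
  rw [show (fun x => x + φ) ⁻¹' Ioo (φ - (1 - R)) (φ + (1 - R)) = Ioo (-(1 - R)) (1 - R) by
    rw [preimage_add_const_Ioo]; congr 1 <;> ring]
  simp only [Function.comp_apply]
  refine lintegral_congr fun θ => lintegral_congr fun ρ => ?_
  congr 1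
  push_cast
  rw [add_mul, Complex.exp_add]
  ring

/-- The radial mass of the polar rectangles in `lintegral_rect_le`. -/
lemma exists_le_radMeas_rect {ν : ℂ → ℝ} (h0 : ∀ z, 0 ≤ ν z) (hνp : WhatPos ν) (hD : Dhat ν)
    {K C : ℝ} (hK : 1 < K) (hC : 1 < C)
    (hKC : ∀ r : ℝ, 0 ≤ r → r < 1 → C * what ν (1 - (1 - r) / K) ≤ what ν r) :
    ∃ c > 0, ∀ R : ℝ, 0 ≤ R → R < 1 → ENNReal.ofReal (c * what ν R) ≤
      (radMeas ν).restrict (Ioc (1 - (1 - R) / 2) (1 - (1 - R) / K / 2)) univ := by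
  obtain ⟨C₂, hC₂, hD⟩ := hD
  refine ⟨(1 - 1 / C) / (2 * C₂), ?_, fun R hR0 hR1 => ?_⟩
  · have : 1 / C < 1 := by rw [div_lt_one (by linarith)]; exact hC
    exact div_pos (by linarith) (by linarith)
  have hδK : 0 < (1 - R) / K := div_pos (by linarith) (by linarith)
  have hδK1 : (1 - R) / K ≤ 1 - R := div_le_self (by linarith) hK.le
  rw [Measure.restrict_apply_univ]
  refine le_trans (ENNReal.ofReal_le_ofReal ?_)
    (ofReal_what_sub_le h0 hνp (by linarith) (by linarith) (by linarith))
  have h1 := hKC (1 - (1 - R) / 2) (by linarith) (by linarith)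
  have h2 := hD R hR0 hR1
  rw [show 1 - (1 - (1 - (1 - R) / 2)) / K = 1 - (1 - R) / K / 2 by ring] at h1
  rw [show (1 + R) / 2 = 1 - (1 - R) / 2 by ring] at h2
  have h3 : what ν (1 - (1 - R) / K / 2) ≤ 1 / C * what ν (1 - (1 - R) / 2) := by
    rw [one_div_mul_eq_div, le_div_iff₀ (by linarith)]
    linarith
  calc (1 - 1 / C) / (2 * C₂) * what ν R
      ≤ (1 - 1 / C) / (2 * C₂) * (C₂ * what ν (1 - (1 - R) / 2)) := by
        refine mul_le_mul_of_nonneg_left h2 (div_nonneg ?_ (by linarith))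
        rw [sub_nonneg, div_le_one (by linarith)]
        exact hC.le
    _ = (what ν (1 - (1 - R) / 2) - 1 / C * what ν (1 - (1 - R) / 2)) / 2 := by
        field_simp
    _ ≤ _ := by linarith

lemma ae_radMeas_mem (ν : ℂ → ℝ) : ∀ᵐ ρ ∂radMeas ν, ρ ∈ Ioo (0 : ℝ) 1 :=
  (withDensity_absolutelyContinuous _ _).ae_le (ae_restrict_mem measurableSet_Ioo)

lemma exists_norm_eq_mul (z : ℂ) : ∃ φ : ℝ, z = Complex.exp (φ * Complex.I) * (‖z‖ : ℝ) :=
  ⟨z.arg, by rw [mul_comm]; exact (Complex.norm_mul_exp_arg_mul_I z).symm⟩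

/-- The upper bound `ν(Δ(z,r)) ≲ (1 - |z|) ν̂(z)`. -/
lemma exists_lintegral_hDisc_le {ν : ℂ → ℝ} (hν : RadialWeight ν) (hνp : WhatPos ν)
    (hD : Dhat ν) (r : ℝ) :
    ∃ C > 0, ∀ z ∈ UD, ∫⁻ ζ in hDisc z r, ENNReal.ofReal (ν ζ) ∂dA ≤
      ENNReal.ofReal (C * ((1 - ‖z‖) * what ν ‖z‖)) := by
  have hπ := Real.pi_pos
  set E := 4 * Real.exp (2 * r) with hE
  have hE0 : 0 < E := by positivity
  obtain ⟨C, hC, hw⟩ := Dhat.exists_what_le_mul hν.1 hνp hD E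
  refine ⟨2 * E * C, by positivity, fun z hz => ?_⟩
  obtain ⟨φ, hφ⟩ := exists_norm_eq_mul z
  have hu := Complex.norm_exp_ofReal_mul_I φ
  rw [mem_UD] at hz
  set R := ‖z‖ with hR
  have hR0 : 0 ≤ R := norm_nonneg z
  have hRU := ofReal_mem_UD hR0 hz
  have hδ : 0 < 1 - R := by linarith
  rw [hφ, setLIntegral_hDisc_mul hu]
  simp only [hν.mul_eq hu]
  have hpol := setLIntegral_hDisc_eq_polar hν hνp (measurable_const (a := (1 : ℝ≥0∞))) (R : ℂ) r
  simp only [one_mul] at hpol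
  rw [hpol]
  set s := max 0 (1 - E * (1 - R)) with hs
  have hs1 : s < 1 := max_lt one_pos (by nlinarith)
  have hinner (θ : ℝ) (hθ : θ ∈ Ioo (-Real.pi) Real.pi) :
      ∫⁻ ρ, (hDisc (R : ℂ) r).indicator (fun _ => (1 : ℝ≥0∞))
        (ρ * Complex.exp (θ * Complex.I)) ∂radMeas ν ≤
      (Icc (-(Real.pi * (E * (1 - R)))) (Real.pi * (E * (1 - R)))).indicator
        (fun _ => ENNReal.ofReal (what ν s)) θ := by
    have hmem (ρ : ℝ) (hρ : ρ ∈ Ioo (0 : ℝ) 1)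
        (h : (ρ : ℂ) * Complex.exp (θ * Complex.I) ∈ hDisc (R : ℂ) r) :
        s ≤ ρ ∧ |θ| ≤ Real.pi * (E * (1 - R)) := by
      have h1 := (norm_one_sub_le_of_mem_hDisc hRU h).1
      have h2 := one_sub_norm_le_norm_one_sub (ζ := (ρ : ℂ) * Complex.exp (θ * Complex.I)) hRU
      have h3 := abs_le_norm_one_sub_exp (x := R * ρ) (θ := θ) (mul_nonneg hR0 hρ.1.le)
        (by nlinarith [hρ.1, hρ.2]) (abs_le.2 ⟨hθ.1.le, hθ.2.le⟩)
      rw [norm_ofReal_mul_exp hρ.1.le] at h2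
      rw [Complex.norm_real, Real.norm_of_nonneg hR0] at h1
      rw [Complex.conj_ofReal] at h1 h2
      rw [Complex.ofReal_mul, mul_assoc] at h3
      exact ⟨max_le hρ.1.le (by linarith), h3.trans (by gcongr)⟩
    by_cases hθE : θ ∈ Icc (-(Real.pi * (E * (1 - R)))) (Real.pi * (E * (1 - R)))
    · rw [indicator_of_mem hθE]
      refine le_trans ?_ (radMeas_Ici_le hν.1 hνp (le_max_left _ _) hs1.le)
      rw [← lintegral_indicator_one measurableSet_Ici]
      refine lintegral_mono_ae ?_
      filter_upwards [ae_radMeas_mem ν] with ρ hρ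
      by_cases h : (ρ : ℂ) * Complex.exp (θ * Complex.I) ∈ hDisc (R : ℂ) r
      · rw [indicator_of_mem h, indicator_of_mem (show ρ ∈ Ici s from (hmem ρ hρ h).1)]
        rfl
      · rw [indicator_of_notMem h]
        exact zero_le
    · rw [indicator_of_notMem hθE, ← lintegral_zero (μ := radMeas ν)]
      refine lintegral_mono_ae ?_
      filter_upwards [ae_radMeas_mem ν] with ρ hρ
      rw [indicator_of_notMem fun h => hθE (abs_le.1 (hmem ρ hρ h).2)]
  calc (ENNReal.ofReal Real.pi)⁻¹ * ∫⁻ θ in Ioo (-Real.pi) Real.pi,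
        ∫⁻ ρ, (hDisc (R : ℂ) r).indicator (fun _ => (1 : ℝ≥0∞))
          (ρ * Complex.exp (θ * Complex.I)) ∂radMeas ν
      ≤ (ENNReal.ofReal Real.pi)⁻¹ *
        ∫⁻ θ, (Icc (-(Real.pi * (E * (1 - R)))) (Real.pi * (E * (1 - R)))).indicator
          (fun _ => ENNReal.ofReal (what ν s)) θ := by
        exact mul_le_mul' le_rfl ((setLIntegral_mono' measurableSet_Ioo hinner).trans
          (setLIntegral_le_lintegral _ _))
    _ = ENNReal.ofReal (2 * E * ((1 - R) * what ν s)) := by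
        rw [lintegral_indicator_const measurableSet_Icc, Real.volume_Icc,
          ← ENNReal.ofReal_inv_of_pos hπ, mul_comm (ENNReal.ofReal (what ν s)),
          ← ENNReal.ofReal_mul (by nlinarith [mul_pos hπ (mul_pos hE0 hδ)]),
          ← ENNReal.ofReal_mul (by positivity)]
        congr 1
        field_simp
        ring
    _ ≤ _ := by
        refine ENNReal.ofReal_le_ofReal ?_
        have : what ν s ≤ C * what ν R := hw s R (le_max_left _ _) hs1 hR0 hz
          (by linarith [le_max_right 0 (1 - E * (1 - R))])
        calc 2 * E * ((1 - R) * what ν s) ≤ 2 * E * ((1 - R) * (C * what ν R)) := by gcongr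
          _ = _ := by ring

lemma RadialWeight.integrableOn_hDisc {ν : ℂ → ℝ} (hν : RadialWeight ν) (z : ℂ) (r : ℝ) :
    IntegrableOn ν (hDisc z r) dA :=
  hν.2.2.mono_set (hDisc_subset_UD z r)

lemma ofReal_nuD {ν : ℂ → ℝ} (hν : RadialWeight ν) (z : ℂ) (r : ℝ) :
    ENNReal.ofReal (nuD ν z r) = ∫⁻ ζ in hDisc z r, ENNReal.ofReal (ν ζ) ∂dA :=
  ofReal_integral_eq_lintegral_ofReal (hν.integrableOn_hDisc z r)
    (Filter.Eventually.of_forall fun _ => hν.1 _)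

lemma gam_pos {ω ν : ℂ → ℝ} (hωp : WhatPos ω) (hνp : WhatPos ν) (p q : ℝ) {z : ℂ} (hz : z ∈ UD) :
    0 < gam ω ν p q z := by
  rw [mem_UD] at hz
  have h1 := hωp _ (norm_nonneg z) hz
  have h2 := hνp _ (norm_nonneg z) hz
  have h3 : 0 < 1 - ‖z‖ := by linarith
  rw [gam]
  positivity

lemma one_sub_norm_le_of_mem_hDisc {z ζ : ℂ} {r : ℝ} (hz : z ∈ UD) (h : ζ ∈ hDisc z r) :
    1 - ‖z‖ ≤ 4 * Real.exp (2 * r) * (1 - ‖ζ‖) := by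
  have := one_sub_norm_le_norm_one_sub (ζ := z) (hDisc_subset_UD z r h)
  rw [norm_one_sub_conj_mul_comm] at this
  exact this.trans (norm_one_sub_le_of_mem_hDisc hz h).2

lemma exists_norm_le_of_mem_hDisc {f : ℂ → ℂ} (hf : DifferentiableOn ℂ f UD) {z : ℂ}
    (hz : z ∈ UD) (r : ℝ) : ∃ S, ∀ ζ ∈ hDisc z r, ‖f ζ‖ ≤ S := by
  set E := 4 * Real.exp (2 * r) with hE
  have hE0 : 0 < E := by positivity
  have hδ : 0 < (1 - ‖z‖) / E := div_pos (sub_pos.2 (mem_UD.1 hz)) hE0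
  have hsub : Metric.closedBall (0 : ℂ) (1 - (1 - ‖z‖) / E) ⊆ UD :=
    Metric.closedBall_subset_ball (by linarith)
  obtain ⟨S, hS⟩ := (isCompact_closedBall (0 : ℂ) _).exists_bound_of_continuousOn
    (hf.continuousOn.mono hsub)
  refine ⟨S, fun ζ hζ => hS ζ ?_⟩
  have : (1 - ‖z‖) / E ≤ 1 - ‖ζ‖ := by
    rw [div_le_iff₀' hE0]
    exact one_sub_norm_le_of_mem_hDisc hz hζ
  rw [mem_closedBall_zero_iff]
  linarith

lemma aestronglyMeasurable_hDisc {f : ℂ → ℂ} (hf : DifferentiableOn ℂ f UD) (z : ℂ) (r : ℝ) :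
    AEStronglyMeasurable f (dA.restrict (hDisc z r)) :=
  (hf.continuousOn.mono (hDisc_subset_UD z r)).aestronglyMeasurable (measurableSet_hDisc z r)

lemma integrableOn_smul_hDisc {ν : ℂ → ℝ} (hν : RadialWeight ν) {f : ℂ → ℂ}
    (hf : DifferentiableOn ℂ f UD) {z : ℂ} (hz : z ∈ UD) (r : ℝ) :
    IntegrableOn (fun ζ => ν ζ • f ζ) (hDisc z r) dA := by
  obtain ⟨S, hS⟩ := exists_norm_le_of_mem_hDisc hf hz r
  have := Integrable.mul_bdd (hν.integrableOn_hDisc z r).ofReal (aestronglyMeasurable_hDisc hf z r)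
    (ae_restrict_of_forall_mem (measurableSet_hDisc z r) hS)
  simp only [Complex.real_smul]
  exact this

lemma integrableOn_rpow_mul_hDisc {ν : ℂ → ℝ} (hν : RadialWeight ν) {f : ℂ → ℂ}
    (hf : DifferentiableOn ℂ f UD) {z : ℂ} (hz : z ∈ UD) (r : ℝ) {q : ℝ} (hq : 0 ≤ q) (a : ℂ) :
    IntegrableOn (fun ζ => ‖f ζ - a‖ ^ q * ν ζ) (hDisc z r) dA := by
  obtain ⟨S, hS⟩ := exists_norm_le_of_mem_hDisc (hf.sub_const a) hz r
  refine Integrable.bdd_mul (c := S ^ q) (hν.integrableOn_hDisc z r)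
    ((Real.continuous_rpow_const hq).comp_aestronglyMeasurable
      (aestronglyMeasurable_hDisc (hf.sub_const a) z r).norm)
    (ae_restrict_of_forall_mem (measurableSet_hDisc z r) fun ζ hζ => ?_)
  rw [Real.norm_of_nonneg (by positivity)]
  exact Real.rpow_le_rpow (norm_nonneg _) (hS ζ hζ) hq

lemma lintegral_osc_le_of_MO_le {ν : ℂ → ℝ} (hν : RadialWeight ν) {f : ℂ → ℂ}
    (hf : DifferentiableOn ℂ f UD) {z : ℂ} (hz : z ∈ UD) {q r B : ℝ} (hq : 1 < q) (hB : 0 < B)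
    (hpos : 0 < nuD ν z r) (hMO : MO ν q r f z ≤ B) :
    ∫⁻ ζ in hDisc z r, ‖f ζ - havg ν r f z‖ₑ * ENNReal.ofReal (ν ζ) ∂dA ≤
      ENNReal.ofReal (2 * B * nuD ν z r) := by
  set a := havg ν r f z with ha
  have hq0 : 0 < q := by linarith
  have hI0 : 0 ≤ ∫ ζ in hDisc z r, ‖f ζ - a‖ ^ q * ν ζ ∂dA :=
    integral_nonneg fun ζ => mul_nonneg (by positivity) (hν.1 ζ)
  have hI : ∫ ζ in hDisc z r, ‖f ζ - a‖ ^ q * ν ζ ∂dA ≤ B ^ q * nuD ν z r := by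
    rw [MO, one_div, Real.rpow_inv_le_iff_of_pos (by positivity) hB.le hq0,
      div_le_iff₀ hpos] at hMO
    exact hMO
  have hint := (hν.integrableOn_hDisc z r).const_mul B
  have hint2 := (integrableOn_rpow_mul_hDisc hν hf hz r hq0.le a).const_mul (B ^ (1 - q))
  calc ∫⁻ ζ in hDisc z r, ‖f ζ - a‖ₑ * ENNReal.ofReal (ν ζ) ∂dA
      ≤ ∫⁻ ζ in hDisc z r,
        ENNReal.ofReal (B * ν ζ + B ^ (1 - q) * (‖f ζ - a‖ ^ q * ν ζ)) ∂dA := by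
        refine lintegral_mono fun ζ => ?_
        rw [← ofReal_norm, ← ENNReal.ofReal_mul (norm_nonneg _), ← mul_assoc, ← add_mul]
        refine ENNReal.ofReal_le_ofReal (mul_le_mul_of_nonneg_right ?_ (hν.1 ζ))
        set x := ‖f ζ - a‖ with hx
        have hx0 : 0 ≤ x := norm_nonneg _
        rcases le_total x B with h | h
        · exact h.trans (le_add_of_nonneg_right (by positivity))
        · have hxp : 0 < x := hB.trans_le h
          have h1 : x ^ (1 - q) ≤ B ^ (1 - q) :=
            Real.rpow_le_rpow_of_nonpos hB h (by linarith)
          calc x = x ^ (1 - q) * x ^ q := by rw [← Real.rpow_add hxp]; simp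
            _ ≤ B ^ (1 - q) * x ^ q := by gcongr
            _ ≤ _ := le_add_of_nonneg_left hB.le
    _ = ENNReal.ofReal (∫ ζ in hDisc z r, (B * ν ζ + B ^ (1 - q) * (‖f ζ - a‖ ^ q * ν ζ)) ∂dA) :=
        (ofReal_integral_eq_lintegral_ofReal (hint.add hint2) (Filter.Eventually.of_forall fun ζ =>
          add_nonneg (mul_nonneg hB.le (hν.1 ζ))
            (mul_nonneg (by positivity) (mul_nonneg (by positivity) (hν.1 ζ))))).symm
    _ ≤ _ := by
        refine ENNReal.ofReal_le_ofReal ?_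
        rw [integral_add hint hint2, integral_const_mul, integral_const_mul]
        have h2 : B ^ (1 - q) * ∫ ζ in hDisc z r, ‖f ζ - a‖ ^ q * ν ζ ∂dA ≤
            B ^ (1 - q) * (B ^ q * nuD ν z r) := by gcongr
        rw [← mul_assoc, ← Real.rpow_add hB, sub_add_cancel, Real.rpow_one] at h2
        rw [← nuD]
        linarith

lemma measurable_indicator_UD {f : ℂ → ℂ} (hf : DifferentiableOn ℂ f UD) :
    Measurable (UD.indicator f) := by
  classical
  rw [← piecewise_eq_indicator]
  exact hf.continuousOn.measurable_piecewise continuousOn_const isOpen_UD.measurableSet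

lemma exists_norm_deriv_mul_gam_le {p q : ℝ} (hq : 1 < q) {ω ν : ℂ → ℝ} (hωp : WhatPos ω)
    (hν : RadialWeight ν) (hνp : WhatPos ν) (hD : Dhat ν) {K C : ℝ} (hK : 1 < K) (hC : 1 < C)
    (hKC : ∀ r : ℝ, 0 ≤ r → r < 1 → C * what ν (1 - (1 - r) / K) ≤ what ν r)
    {r : ℝ} (hr : 72 * K ≤ r) (hpos : ∀ z ∈ UD, 0 < nuD ν z r)
    {f : ℂ → ℂ} (hf : DifferentiableOn ℂ f UD) (hBMO : BMOfin ω ν p q r f) :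
    ∃ M : ℝ, ∀ z ∈ UD, ‖deriv f z‖ * (1 - ‖z‖) * gam ω ν p q z ≤ M := by
  have hπ := Real.pi_pos
  obtain ⟨M, hM⟩ := hBMO
  set M₁ := max M 1 with hM₁def
  have hM₁ : 0 < M₁ := lt_max_of_lt_right one_pos
  obtain ⟨c, hc, hmass⟩ := exists_le_radMeas_rect hν.1 hνp hD hK hC hKC
  obtain ⟨C', hC', hup⟩ := exists_lintegral_hDisc_le hν hνp hD r
  refine ⟨221184 * Real.pi ^ 4 * M₁ * C' / c, fun z hz => ?_⟩
  have hγ := gam_pos hωp hνp p q hz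
  obtain ⟨φ₀, hφ₀⟩ := exists_norm_eq_mul z
  set u := Complex.exp (φ₀ * Complex.I) with hudef
  have hu : ‖u‖ = 1 := Complex.norm_exp_ofReal_mul_I φ₀
  have hR1 : ‖z‖ < 1 := mem_UD.1 hz
  have hR0 : 0 ≤ ‖z‖ := norm_nonneg z
  set R := ‖z‖ with hR
  have hδ : 0 < 1 - R := by linarith
  have hw := hνp R hR0 hR1
  set B := M₁ / gam ω ν p q z with hBdef
  have hB : 0 < B := div_pos hM₁ hγ
  have hFm := measurable_indicator_UD hf
  have huUD {ζ : ℂ} (hζ : ζ ∈ UD) : u * ζ ∈ UD := by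
    rw [mem_UD] at hζ ⊢; rwa [norm_mul, hu, one_mul]
  set g : ℂ → ℂ := fun ζ => UD.indicator f (u * ζ) with hg
  have hgf {ζ : ℂ} (hζ : ζ ∈ UD) : g ζ = f (u * ζ) := indicator_of_mem (huUD hζ) f
  have hgd : DifferentiableOn ℂ g UD :=
    DifferentiableOn.congr (hf.comp (by fun_prop) fun ζ hζ => huUD hζ) fun ζ hζ => hgf hζ
  have hgm : Measurable g := hFm.comp (measurable_const_mul u)
  have hderiv : ‖deriv g R‖ = ‖deriv f z‖ := by
    have : g =ᶠ[nhds (R : ℂ)] fun ζ => f (u * ζ) :=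
      Filter.eventually_of_mem (isOpen_UD.mem_nhds (ofReal_mem_UD hR0 hR1)) fun ζ hζ => hgf hζ
    rw [this.deriv_eq, deriv_comp_mul_left, norm_smul, hu, one_mul, ← hφ₀]
  have hκ : ∀ᵐ ρ ∂(radMeas ν).restrict (Ioc (1 - (1 - R) / 2) (1 - (1 - R) / K / 2)),
      ρ ∈ Ico (1 - (1 - R) / 2) 1 := by
    refine ae_restrict_of_forall_mem measurableSet_Ioc fun ρ hρ => ⟨hρ.1.le, ?_⟩
    have : 0 < (1 - R) / K := div_pos hδ (by linarith)
    linarith [hρ.2]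
  have hosc (φ : ℝ) : ∫⁻ θ in Ioo (φ - (1 - R)) (φ + (1 - R)),
      ∫⁻ ρ, ‖g (ρ * Complex.exp (θ * Complex.I)) -
        havg ν r f (u * (Complex.exp (φ * Complex.I) * R))‖ₑ
        ∂(radMeas ν).restrict (Ioc (1 - (1 - R) / 2) (1 - (1 - R) / K / 2)) ≤
      ENNReal.ofReal (Real.pi * (2 * B * (C' * ((1 - R) * what ν R)))) := by
    set z' := u * (Complex.exp (φ * Complex.I) * R) with hz'
    have hnz' : ‖z'‖ = R := by
      rw [hz', norm_mul, hu, one_mul, mul_comm, norm_ofReal_mul_exp hR0]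
    have hz'U : z' ∈ UD := by rwa [mem_UD, hnz']
    have hγ' : gam ω ν p q z' = gam ω ν p q z := by rw [gam, gam, hnz', ← hR]
    have hMO : MO ν q r f z' ≤ B := by
      rw [hBdef, le_div_iff₀ hγ, ← hγ']
      exact (hM z' hz'U).trans (le_max_left _ _)
    refine (lintegral_rect_rotate_le (F := fun ζ => ‖g ζ - havg ν r f z'‖ₑ) hν hνp
      (hgm.sub_const _).enorm hR0 hR1 hK hr φ).trans ?_
    rw [ENNReal.ofReal_mul hπ.le]
    gcongr
    have hrot := setLIntegral_hDisc_mul hu (Complex.exp (φ * Complex.I) * R) r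
      fun ζ => ‖UD.indicator f ζ - havg ν r f z'‖ₑ * ENNReal.ofReal (ν ζ)
    simp only [hν.mul_eq hu] at hrot
    rw [← hrot]
    calc ∫⁻ ζ in hDisc z' r, ‖UD.indicator f ζ - havg ν r f z'‖ₑ * ENNReal.ofReal (ν ζ) ∂dA
        = ∫⁻ ζ in hDisc z' r, ‖f ζ - havg ν r f z'‖ₑ * ENNReal.ofReal (ν ζ) ∂dA :=
          setLIntegral_congr_fun (measurableSet_hDisc z' r) fun ζ hζ => by
            simp only [indicator_of_mem (hDisc_subset_UD z' r hζ)]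
      _ ≤ ENNReal.ofReal (2 * B * nuD ν z' r) :=
          lintegral_osc_le_of_MO_le hν hf hz'U hq hB (hpos z' hz'U) hMO
      _ ≤ _ := by
          have hnu := hup z' hz'U
          rw [← ofReal_nuD hν, hnz', ENNReal.ofReal_le_ofReal_iff (by positivity)] at hnu
          gcongr
  have key := norm_deriv_le_of_oscillation hgd hgm hR0 hR1 hκ (by positivity)
    (mul_pos hc hw) (hmass R hR0 hR1) hosc
  rw [hderiv] at key
  calc ‖deriv f z‖ * (1 - R) * gam ω ν p q z
      ≤ 110592 * Real.pi ^ 3 * (Real.pi * (2 * B * (C' * ((1 - R) * what ν R)))) /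
        ((1 - R) ^ 2 * (c * what ν R)) * (1 - R) * gam ω ν p q z := by gcongr
    _ = _ := by
      rw [hBdef]
      field_simp
      ring

/-- `γ` does not decrease much along segments contained in hyperbolic discs. -/
lemma exists_gam_le_on_segment {p q : ℝ} (hp : 0 < p) (hq : 0 < q) {ω ν : ℂ → ℝ}
    (hω : RadialWeight ω) (hωp : WhatPos ω) (hωD : Dhat ω) (hν : RadialWeight ν)
    (hνp : WhatPos ν) (hνD : Dhat ν) {r : ℝ} (hr : 0 ≤ r) :
    ∃ k > 0, ∀ z ∈ UD, ∀ ζ ∈ hDisc z r, ∀ ξ ∈ segment ℝ z ζ, ξ ∈ UD ∧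
      1 - ‖z‖ ≤ 4 * Real.exp (2 * r) * (1 - ‖ξ‖) ∧ k * gam ω ν p q z ≤ gam ω ν p q ξ := by
  set E := 4 * Real.exp (2 * r) with hE
  have hE1 : 1 ≤ E := by
    have := Real.one_le_exp (show 0 ≤ 2 * r by linarith)
    linarith
  have hE0 : 0 < E := by positivity
  obtain ⟨C₁, hC₁, h₁⟩ := Dhat.exists_what_le_mul hν.1 hνp hνD E
  obtain ⟨C₂, hC₂, h₂⟩ := Dhat.exists_what_le_mul hω.1 hωp hωD (1 + E)
  refine ⟨((1 / C₁) ^ (1 / q) * (1 / E) ^ (1 / q)) / (C₂ ^ (1 / p) * (1 + E) ^ (1 / p)),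
    by positivity, fun z hz ζ hζ ξ hξ => ?_⟩
  have hz1 := mem_UD.1 hz
  have hδ : 0 < 1 - ‖z‖ := by linarith
  have hζ1 := hDisc_subset_UD z r hζ
  have hξ1 : ξ ∈ UD := (convex_ball (0 : ℂ) 1).segment_subset hz hζ1 hξ
  have hξn := mem_UD.1 hξ1
  have hdξ : 0 < 1 - ‖ξ‖ := by linarith
  have hlow : 1 - ‖z‖ ≤ E * (1 - ‖ξ‖) := by
    have hζE : (1 - ‖z‖) / E ≤ 1 - ‖ζ‖ := by
      rw [div_le_iff₀' hE0]; exact one_sub_norm_le_of_mem_hDisc hz hζ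
    have := (convex_closedBall (0 : ℂ) (1 - (1 - ‖z‖) / E)).segment_subset (x := z) (y := ζ)
      (by rw [mem_closedBall_zero_iff]; linarith [div_le_self hδ.le hE1])
      (by rw [mem_closedBall_zero_iff]; linarith) hξ
    rw [mem_closedBall_zero_iff] at this
    rw [← div_le_iff₀' hE0]
    linarith
  have hup : 1 - ‖ξ‖ ≤ (1 + E) * (1 - ‖z‖) := by
    have h := (convex_closedBall z (E * (1 - ‖z‖))).segment_subset (x := z) (y := ζ)
      (Metric.mem_closedBall_self (by positivity))
      (by
        rw [mem_closedBall_iff_norm, norm_sub_rev]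
        exact (norm_sub_lt_norm_one_sub hz hζ1).le.trans
          (norm_one_sub_le_of_mem_hDisc hz hζ).1) hξ
    rw [mem_closedBall_iff_norm, norm_sub_rev] at h
    linarith [norm_sub_norm_le z ξ]
  refine ⟨hξ1, hlow, ?_⟩
  have hνz := h₁ _ _ (norm_nonneg z) hz1 (norm_nonneg ξ) hξn hlow
  have hωξ := h₂ _ _ (norm_nonneg ξ) hξn (norm_nonneg z) hz1 hup
  have e1 := hωp _ (norm_nonneg z) hz1
  have e2 := hωp _ (norm_nonneg ξ) hξn
  have e3 := hνp _ (norm_nonneg z) hz1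
  have e4 := hνp _ (norm_nonneg ξ) hξn
  rw [gam, gam, div_mul_div_comm]
  have hnum : (1 / C₁) ^ (1 / q) * (1 / E) ^ (1 / q) *
      (what ν ‖z‖ ^ (1 / q) * (1 - ‖z‖) ^ (1 / q)) =
      (1 / C₁ * what ν ‖z‖) ^ (1 / q) * (1 / E * (1 - ‖z‖)) ^ (1 / q) := by
    rw [Real.mul_rpow (by positivity) e3.le, Real.mul_rpow (by positivity) hδ.le]
    ring
  have hden : C₂ ^ (1 / p) * (1 + E) ^ (1 / p) *
      (what ω ‖z‖ ^ (1 / p) * (1 - ‖z‖) ^ (1 / p)) =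
      (C₂ * what ω ‖z‖) ^ (1 / p) * ((1 + E) * (1 - ‖z‖)) ^ (1 / p) := by
    rw [Real.mul_rpow hC₂.le e1.le, Real.mul_rpow (by positivity) hδ.le]
    ring
  rw [hnum, hden]
  gcongr
  · rwa [one_div_mul_eq_div, div_le_iff₀' hC₁]
  · rwa [one_div_mul_eq_div, div_le_iff₀' hE0]

lemma MO_le_of_norm_sub_le {ν : ℂ → ℝ} (hν : RadialWeight ν) {f : ℂ → ℂ}
    (hf : DifferentiableOn ℂ f UD) {z : ℂ} (hz : z ∈ UD) {q r B : ℝ} (hq : 0 < q)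
    (hpos : 0 < nuD ν z r) (hB0 : 0 ≤ B) {a : ℂ} (hB : ∀ ζ ∈ hDisc z r, ‖f ζ - a‖ ≤ B) :
    MO ν q r f z ≤ 2 * B := by
  have havg_sub : ‖havg ν r f z - a‖ ≤ B := by
    have hne : ((nuD ν z r : ℝ) : ℂ) ≠ 0 := by exact_mod_cast hpos.ne'
    have heq : havg ν r f z - a =
        (∫ ζ in hDisc z r, ν ζ • (f ζ - a) ∂dA) / ((nuD ν z r : ℝ) : ℂ) := by
      rw [havg, eq_div_iff hne, sub_mul, div_mul_cancel₀ _ hne]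
      simp only [smul_sub]
      rw [integral_sub (integrableOn_smul_hDisc hν hf hz r)
        ((hν.integrableOn_hDisc z r).smul_const a), integral_smul_const, ← nuD,
        Complex.real_smul, mul_comm a]
    rw [heq, norm_div, Complex.norm_real, Real.norm_of_nonneg hpos.le, div_le_iff₀ hpos, nuD,
      ← integral_const_mul]
    refine norm_integral_le_of_norm_le ((hν.integrableOn_hDisc z r).const_mul B)
      (ae_restrict_of_forall_mem (measurableSet_hDisc z r) fun ζ hζ => ?_)
    rw [norm_smul, Real.norm_of_nonneg (hν.1 ζ), mul_comm]
    exact mul_le_mul_of_nonneg_right (hB ζ hζ) (hν.1 ζ)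
  have hosc : ∀ ζ ∈ hDisc z r, ‖f ζ - havg ν r f z‖ ≤ 2 * B := fun ζ hζ => by
    rw [norm_sub_rev] at havg_sub
    linarith [hB ζ hζ, norm_sub_le_norm_sub_add_norm_sub (f ζ) a (havg ν r f z)]
  have hI0 : 0 ≤ ∫ ζ in hDisc z r, ‖f ζ - havg ν r f z‖ ^ q * ν ζ ∂dA :=
    integral_nonneg fun ζ => mul_nonneg (by positivity) (hν.1 ζ)
  rw [MO, one_div, Real.rpow_inv_le_iff_of_pos (by positivity) (by positivity) hq,
    div_le_iff₀ hpos, nuD, ← integral_const_mul]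
  refine setIntegral_mono_on (integrableOn_rpow_mul_hDisc hν hf hz r hq.le _)
    ((hν.integrableOn_hDisc z r).const_mul _) (measurableSet_hDisc z r) fun ζ hζ => ?_
  exact mul_le_mul_of_nonneg_right
    (Real.rpow_le_rpow (norm_nonneg _) (hosc ζ hζ) hq.le) (hν.1 ζ)

lemma BMOfin_of_bloch {p q : ℝ} (hp : 0 < p) (hq : 0 < q) {ω ν : ℂ → ℝ}
    (hω : RadialWeight ω) (hωp : WhatPos ω) (hωD : Dhat ω) (hν : RadialWeight ν)
    (hνp : WhatPos ν) (hνD : Dhat ν) {r : ℝ} (hr : 0 ≤ r) (hpos : ∀ z ∈ UD, 0 < nuD ν z r)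
    {f : ℂ → ℂ} (hf : DifferentiableOn ℂ f UD) {M : ℝ}
    (hM : ∀ z ∈ UD, ‖deriv f z‖ * (1 - ‖z‖) * gam ω ν p q z ≤ M) : BMOfin ω ν p q r f := by
  obtain ⟨k, hk, hseg⟩ := exists_gam_le_on_segment hp hq hω hωp hωD hν hνp hνD hr
  set E := 4 * Real.exp (2 * r) with hE
  have hE0 : 0 < E := by positivity
  have hM0 : 0 ≤ M := by
    refine le_trans ?_ (hM 0 (by simp [mem_UD]))
    have := gam_pos hωp hνp p q (z := 0) (by simp [mem_UD])
    rw [norm_zero, sub_zero]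
    positivity
  refine ⟨2 * (E ^ 2 * M / k), fun z hz => ?_⟩
  have hγ := gam_pos hωp hνp p q hz
  have hδ : 0 < 1 - ‖z‖ := sub_pos.2 (mem_UD.1 hz)
  have hMO : MO ν q r f z ≤ 2 * (E ^ 2 * M / (k * gam ω ν p q z)) := by
    refine MO_le_of_norm_sub_le hν hf hz hq (hpos z hz) (by positivity) (a := f z)
      fun ζ hζ => ?_
    have hd : ∀ ξ ∈ segment ℝ z ζ, ‖deriv f ξ‖ ≤ E * M / ((1 - ‖z‖) * (k * gam ω ν p q z)) := by
      intro ξ hξ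
      obtain ⟨hξU, h1, h2⟩ := hseg z hz ζ hζ ξ hξ
      rw [le_div_iff₀ (by positivity)]
      calc ‖deriv f ξ‖ * ((1 - ‖z‖) * (k * gam ω ν p q z))
          ≤ ‖deriv f ξ‖ * (E * (1 - ‖ξ‖) * gam ω ν p q ξ) := by
            have := hδ.le.trans h1
            gcongr
        _ = E * (‖deriv f ξ‖ * (1 - ‖ξ‖) * gam ω ν p q ξ) := by ring
        _ ≤ E * M := by gcongr; exact hM ξ hξU
    have hdist : ‖ζ - z‖ ≤ E * (1 - ‖z‖) := by
      rw [norm_sub_rev]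
      exact (norm_sub_lt_norm_one_sub hz (hDisc_subset_UD z r hζ)).le.trans
        (norm_one_sub_le_of_mem_hDisc hz hζ).1
    have := (convex_segment z ζ).norm_image_sub_le_of_norm_deriv_le
      (fun ξ hξ => hf.differentiableAt (isOpen_UD.mem_nhds (hseg z hz ζ hζ ξ hξ).1)) hd
      (left_mem_segment ℝ z ζ) (right_mem_segment ℝ z ζ)
    calc ‖f ζ - f z‖ ≤ E * M / ((1 - ‖z‖) * (k * gam ω ν p q z)) * (E * (1 - ‖z‖)) :=
          this.trans (by gcongr)
      _ = _ := by field_simp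
  calc MO ν q r f z * gam ω ν p q z
      ≤ 2 * (E ^ 2 * M / (k * gam ω ν p q z)) * gam ω ν p q z := by gcongr
    _ = _ := by field_simp

lemma nuD_pos {ν : ℂ → ℝ} (hν : RadialWeight ν) (hνp : WhatPos ν) (hD : Dhat ν)
    {K C : ℝ} (hK : 1 < K) (hC : 1 < C)
    (hKC : ∀ r : ℝ, 0 ≤ r → r < 1 → C * what ν (1 - (1 - r) / K) ≤ what ν r)
    {r : ℝ} (hr : 72 * K ≤ r) {z : ℂ} (hz : z ∈ UD) : 0 < nuD ν z r := by
  obtain ⟨c, hc, hmass⟩ := exists_le_radMeas_rect hν.1 hνp hD hK hC hKC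
  obtain ⟨φ, hφ⟩ := exists_norm_eq_mul z
  have hR1 : ‖z‖ < 1 := mem_UD.1 hz
  have h := lintegral_rect_rotate_le hν hνp (measurable_const (a := (1 : ℝ≥0∞)))
    (norm_nonneg z) hR1 hK hr φ
  simp only [one_mul, lintegral_one] at h
  rw [← hφ, ← ofReal_nuD hν, setLIntegral_const, Real.volume_Ioo] at h
  by_contra! hle
  rw [ENNReal.ofReal_of_nonpos hle, mul_zero, nonpos_iff_eq_zero, mul_eq_zero] at h
  rcases h with h | h
  · have := hmass ‖z‖ (norm_nonneg z) hR1
    rw [h, nonpos_iff_eq_zero, ENNReal.ofReal_eq_zero] at this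
    exact absurd (mul_pos hc (hνp _ (norm_nonneg z) hR1)) this.not_gt
  · rw [ENNReal.ofReal_eq_zero] at h
    linarith

/-- Proposition 6.1: for analytic `f`, membership in `BMO(Δ)_{ω,ν,p,q,r}`
is the same as membership in the Bloch-type space `B_{dγ}`. -/
theorem analytic_BMO_iff_bloch (p q : ℝ) (hp : 1 < p) (hpq : p ≤ q)
    (ω ν : ℂ → ℝ) (hω : RadialWeight ω) (hωp : WhatPos ω) (hωD : Dclass ω)
    (hν : RadialWeight ν) (hνp : WhatPos ν) (hνD : Dclass ν) :
    ∃ r0 > (0 : ℝ),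
      (∀ z ∈ UD, ∀ r : ℝ, r0 ≤ r → 0 < nuD ν z r) ∧
      ∀ r : ℝ, r0 ≤ r → ∀ f : ℂ → ℂ, DifferentiableOn ℂ f UD →
        (BMOfin ω ν p q r f ↔
          ∃ M : ℝ, ∀ z ∈ UD, ‖deriv f z‖ * (1 - ‖z‖) * gam ω ν p q z ≤ M) := by
  obtain ⟨hD, K, hK, C, hC, hKC⟩ := hνD
  have hpos {r : ℝ} (hr : 72 * K ≤ r) (z : ℂ) (hz : z ∈ UD) : 0 < nuD ν z r :=
    nuD_pos hν hνp hD hK hC hKC hr hz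
  refine ⟨72 * K, by positivity, fun z hz r hr => hpos hr z hz, fun r hr f hf => ⟨?_, ?_⟩⟩
  · exact exists_norm_deriv_mul_gam_le (hp.trans_le hpq) hωp hν hνp hD hK hC hKC hr (hpos hr) hf
  · rintro ⟨M, hM⟩
    exact BMOfin_of_bloch (by linarith) (by linarith) hω hωp hωD.1 hν hνp hD
      (by linarith) (hpos hr) hf hM
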